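/- arXiv:1705.05790 — 4 statements merged into one kernel-verified Lean document; each statement's English description precedes it below -/
import Mathlib

section
/- In the transition graph 𝒢(A) of the hexagonal annulus A, the perfect matchings N₁ and N₂ are isolated vertices (neither admits any switch), and all remaining perfect matchings of A lie in a single connected component of 𝒢(A). -/
/-- Outer-hexagon vertex `aⱼ` (indexed by `ZMod 6`, with `aⱼ` for
`j ∈ {1,…,6}` corresponding to `j - 1 : ZMod 6`). -/
def av (j : ZMod 6) : ZMod 6 ⊕ ZMod 6 := Sum.inl j

/-- Inner-hexagon vertex `bⱼ`. -/
def bv (j : ZMod 6) : ZMod 6 ⊕ ZMod 6 := Sum.inr j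

/-- The hexagonal annulus `A`: two concentric hexagons `a₁…a₆`, `b₁…b₆`
joined by the six spokes `aⱼbⱼ`. -/
def Annulus : SimpleGraph (ZMod 6 ⊕ ZMod 6) :=
  SimpleGraph.fromRel fun x y =>
    match x, y with
    | Sum.inl j, Sum.inl j' => j' = j + 1
    | Sum.inr j, Sum.inr j' => j' = j + 1
    | Sum.inl j, Sum.inr j' => j = j'
    | Sum.inr _, Sum.inl _ => False

/-- The perfect matching `N₁ = {a₁a₂, a₃a₄, a₅a₆, b₂b₃, b₄b₅, b₆b₁}`. -/
def AnnulusN1 : Set (Sym2 (ZMod 6 ⊕ ZMod 6)) :=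
  {s(av 0, av 1), s(av 2, av 3), s(av 4, av 5),
   s(bv 1, bv 2), s(bv 3, bv 4), s(bv 5, bv 0)}

/-- The perfect matching `N₂ = {a₂a₃, a₄a₅, a₆a₁, b₁b₂, b₃b₄, b₅b₆}`. -/
def AnnulusN2 : Set (Sym2 (ZMod 6 ⊕ ZMod 6)) :=
  {s(av 1, av 2), s(av 3, av 4), s(av 5, av 0),
   s(bv 0, bv 1), s(bv 2, bv 3), s(bv 4, bv 5)}

/-- A perfect matching of `G`, viewed as a set of edges: a set of pairwise
disjoint edges of `G` covering every vertex. -/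
def IsPM {V : Type*} (G : SimpleGraph V) (M : Set (Sym2 V)) : Prop :=
  M ⊆ G.edgeSet ∧
    (∀ e ∈ M, ∀ f ∈ M, e ≠ f → ∀ v : V, ¬(v ∈ e ∧ v ∈ f)) ∧
    (∀ v : V, ∃ e ∈ M, v ∈ e)

/-- Two perfect matchings differ by a switch. -/
def IsSwitch {V : Type*} (G : SimpleGraph V) (M M' : Set (Sym2 V)) : Prop :=
  ∃ u v u' v' : V, u ≠ v ∧ u ≠ u' ∧ u ≠ v' ∧ v ≠ u' ∧ v ≠ v' ∧ u' ≠ v' ∧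
    s(u, v) ∈ M ∧ s(u', v') ∈ M ∧ G.Adj u' v ∧ G.Adj u v' ∧
    M' = (M \ {s(u, v), s(u', v')}) ∪ {s(u', v), s(u, v')}

/-- The transition graph of the switch chain on `G`: vertices are the perfect
matchings of `G`, two of them adjacent iff they differ by a switch. -/
def TransGraph {V : Type*} (G : SimpleGraph V) :
    SimpleGraph {M : Set (Sym2 V) // IsPM G M} :=
  SimpleGraph.fromRel fun M N => IsSwitch G M.1 N.1

/-- Adjacency of the annulus, unfolded. -/
lemma annulus_adj_iff (x y : ZMod 6 ⊕ ZMod 6) : Annulus.Adj x y ↔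
    (match x, y with
    | Sum.inl j, Sum.inl j' => j' = j + 1 ∨ j = j' + 1
    | Sum.inr j, Sum.inr j' => j' = j + 1 ∨ j = j' + 1
    | Sum.inl j, Sum.inr j' => j = j'
    | Sum.inr j, Sum.inl j' => j = j') := by
  unfold Annulus
  rw [SimpleGraph.fromRel_adj]
  rcases x with j | j <;> rcases y with k | k <;> simp
  · revert j k; decide
  · exact eq_comm
  · revert j k; decide

instance annulusDec : DecidableRel Annulus.Adj := fun x y =>
  match x, y with
  | Sum.inl _, Sum.inl _ => decidable_of_iff _ (annulus_adj_iff _ _).symm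
  | Sum.inr _, Sum.inr _ => decidable_of_iff _ (annulus_adj_iff _ _).symm
  | Sum.inl _, Sum.inr _ => decidable_of_iff _ (annulus_adj_iff _ _).symm
  | Sum.inr _, Sum.inl _ => decidable_of_iff _ (annulus_adj_iff _ _).symm

def FN1 : Finset (Sym2 (ZMod 6 ⊕ ZMod 6)) :=
  {s(av 0, av 1), s(av 2, av 3), s(av 4, av 5),
   s(bv 1, bv 2), s(bv 3, bv 4), s(bv 5, bv 0)}

def FN2 : Finset (Sym2 (ZMod 6 ⊕ ZMod 6)) :=
  {s(av 1, av 2), s(av 3, av 4), s(av 5, av 0),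
   s(bv 0, bv 1), s(bv 2, bv 3), s(bv 4, bv 5)}

lemma mem_N1 (e : Sym2 (ZMod 6 ⊕ ZMod 6)) : e ∈ AnnulusN1 ↔ e ∈ FN1 := by
  simp [AnnulusN1, FN1]

lemma mem_N2 (e : Sym2 (ZMod 6 ⊕ ZMod 6)) : e ∈ AnnulusN2 ↔ e ∈ FN2 := by
  simp [AnnulusN2, FN2]

lemma pm_N1 : IsPM Annulus AnnulusN1 := by
  simp only [IsPM, mem_N1, Set.subset_def]
  refine ⟨?_, ?_, ?_⟩ <;> decide +kernel

lemma pm_N2 : IsPM Annulus AnnulusN2 := by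
  simp only [IsPM, mem_N2, Set.subset_def]
  refine ⟨?_, ?_, ?_⟩ <;> decide +kernel

set_option synthInstance.maxHeartbeats 400000 in
set_option synthInstance.maxSize 2000 in
lemma noswitch_N1 : ∀ u v, s(u, v) ∈ FN1 → ∀ u' v', s(u', v') ∈ FN1 → u ≠ u' → u ≠ v' →
    Annulus.Adj u' v → ¬ Annulus.Adj u v' := by decide +kernel

set_option synthInstance.maxHeartbeats 400000 in
set_option synthInstance.maxSize 2000 in
lemma noswitch_N2 : ∀ u v, s(u, v) ∈ FN2 → ∀ u' v', s(u', v') ∈ FN2 → u ≠ u' → u ≠ v' →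
    Annulus.Adj u' v → ¬ Annulus.Adj u v' := by decide +kernel

/-- If no alternating four-cycle exists at `N`, then `N` is isolated. -/
lemma isolated_of {V : Type*} {G : SimpleGraph V} {N : Set (Sym2 V)} (hN : IsPM G N)
    (h : ∀ u v, s(u, v) ∈ N → ∀ u' v', s(u', v') ∈ N → u ≠ u' → u ≠ v' →
      G.Adj u' v → ¬ G.Adj u v')
    (M : {M : Set (Sym2 V) // IsPM G M}) : ¬ (TransGraph G).Adj ⟨N, hN⟩ M := by
  unfold TransGraph
  rw [SimpleGraph.fromRel_adj]
  rintro ⟨-, h' | h'⟩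
  · obtain ⟨u, v, u', v', -, h2, h3, -, -, -, e1, e2, a1, a2, -⟩ := h'
    exact h u v e1 u' v' e2 h2 h3 a1 a2
  · obtain ⟨u, v, u', v', h1, h2, h3, h4, h5, h6, e1, e2, a1, a2, e⟩ := h'
    have m1 : s(u, v') ∈ N := by
      have : N = _ := e
      rw [this]; simp
    have m2 : s(u', v) ∈ N := by
      have : N = _ := e
      rw [this]; simp
    exact h u v' m1 u' v m2 h2 h1 (M.2.1 e2) (M.2.1 e1)

/-- Switching a perfect matching yields a perfect matching. -/
lemma switch_pm {V : Type*} {G : SimpleGraph V} {M : Set (Sym2 V)} (hM : IsPM G M)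
    {u v u' v' : V} (h2 : u ≠ u') (h5 : v ≠ v') (h3 : u ≠ v') (h4 : v ≠ u')
    (e1 : s(u, v) ∈ M) (e2 : s(u', v') ∈ M)
    (a1 : G.Adj u' v) (a2 : G.Adj u v') :
    IsPM G ((M \ {s(u, v), s(u', v')}) ∪ {s(u', v), s(u, v')}) := by
  have h1 : u ≠ v := (show G.Adj u v from hM.1 e1).ne
  have h6 : u' ≠ v' := (show G.Adj u' v' from hM.1 e2).ne
  obtain ⟨hs, hd, hc⟩ := hM
  have key : ∀ e ∈ M \ {s(u, v), s(u', v')}, u ∉ e ∧ v ∉ e ∧ u' ∉ e ∧ v' ∉ e := by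
    rintro e ⟨he, hne⟩
    simp only [Set.mem_insert_iff, Set.mem_singleton_iff, not_or] at hne
    refine ⟨fun h => hd e he _ e1 hne.1 u ⟨h, by simp⟩,
      fun h => hd e he _ e1 hne.1 v ⟨h, by simp⟩,
      fun h => hd e he _ e2 hne.2 u' ⟨h, by simp⟩,
      fun h => hd e he _ e2 hne.2 v' ⟨h, by simp⟩⟩
  refine ⟨?_, ?_, ?_⟩
  · rintro e (he | he | he)
    · exact hs he.1
    · subst he; exact a1
    · rw [Set.mem_singleton_iff] at he; subst he; exact a2
  · rintro e he f hf hef w ⟨hwe, hwf⟩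
    simp only [Set.mem_union, Set.mem_insert_iff, Set.mem_singleton_iff] at he hf
    rcases he with he | rfl | rfl <;> rcases hf with hf | rfl | rfl
    · exact hd e he.1 f hf.1 hef w ⟨hwe, hwf⟩
    · have := key e he
      rcases Sym2.mem_iff.1 hwf with rfl | rfl <;> tauto
    · have := key e he
      rcases Sym2.mem_iff.1 hwf with rfl | rfl <;> tauto
    · have := key f hf
      rcases Sym2.mem_iff.1 hwe with rfl | rfl <;> tauto
    · exact hef rfl
    · rcases Sym2.mem_iff.1 hwe with rfl | rfl <;> rcases Sym2.mem_iff.1 hwf with h | h <;>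
        first | exact h2 h.symm | exact h1 h.symm | exact h6 h | exact h5 h
    · have := key f hf
      rcases Sym2.mem_iff.1 hwe with rfl | rfl <;> tauto
    · rcases Sym2.mem_iff.1 hwe with rfl | rfl <;> rcases Sym2.mem_iff.1 hwf with h | h <;>
        first | exact h2 h | exact h5 h.symm | exact h1 h | exact h6 h.symm
    · exact hef rfl
  · intro w
    by_cases hw : w = u ∨ w = v ∨ w = u' ∨ w = v'
    · rcases hw with rfl | rfl | rfl | rfl
      · exact ⟨s(w, v'), by simp, by simp⟩
      · exact ⟨s(u', w), by simp, by simp⟩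
      · exact ⟨s(w, v), by simp, by simp⟩
      · exact ⟨s(u, w), by simp, by simp⟩
    · obtain ⟨e, he, hwe⟩ := hc w
      refine ⟨e, Or.inl ⟨he, ?_⟩, hwe⟩
      simp only [Set.mem_insert_iff, Set.mem_singleton_iff]
      rintro (rfl | rfl)
      · rw [Sym2.mem_iff] at hwe; tauto
      · rw [Sym2.mem_iff] at hwe; tauto

abbrev VV := ZMod 6 ⊕ ZMod 6

/-- The edges of the outer hexagon, of the inner hexagon, and the spokes. -/
def ea (i : ZMod 6) : Sym2 VV := s(Sum.inl i, Sum.inl (i + 1))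
def eb (i : ZMod 6) : Sym2 VV := s(Sum.inr i, Sum.inr (i + 1))
def es (i : ZMod 6) : Sym2 VV := s(Sum.inl i, Sum.inr i)

lemma edge_cases (e : Sym2 VV) (he : e ∈ Annulus.edgeSet) :
    (∃ i, e = ea i) ∨ (∃ i, e = eb i) ∨ ∃ i, e = es i := by
  induction e using Sym2.ind with
  | _ x y =>
    have h := (annulus_adj_iff x y).1 he
    rcases x with j | j <;> rcases y with k | k <;> simp only at h
    · rcases h with rfl | rfl
      · exact Or.inl ⟨j, rfl⟩
      · exact Or.inl ⟨k, Sym2.eq_swap⟩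
    · subst h; exact Or.inr (Or.inr ⟨j, rfl⟩)
    · subst h; exact Or.inr (Or.inr ⟨j, Sym2.eq_swap⟩)
    · rcases h with rfl | rfl
      · exact Or.inr (Or.inl ⟨j, rfl⟩)
      · exact Or.inr (Or.inl ⟨k, Sym2.eq_swap⟩)

lemma pm_ext {M N : Set (Sym2 VV)} (hM : IsPM Annulus M) (hN : IsPM Annulus N)
    (ha : ∀ i, ea i ∈ M ↔ ea i ∈ N) (hb : ∀ i, eb i ∈ M ↔ eb i ∈ N)
    (hz : ∀ i, es i ∈ M ↔ es i ∈ N) : M = N := by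
  ext e
  constructor
  · intro h
    rcases edge_cases e (hM.1 h) with ⟨i, rfl⟩ | ⟨i, rfl⟩ | ⟨i, rfl⟩
    · exact (ha i).1 h
    · exact (hb i).1 h
    · exact (hz i).1 h
  · intro h
    rcases edge_cases e (hN.1 h) with ⟨i, rfl⟩ | ⟨i, rfl⟩ | ⟨i, rfl⟩
    · exact (ha i).2 h
    · exact (hb i).2 h
    · exact (hz i).2 h

lemma mem_inl_iff : ∀ i j : ZMod 6, ((Sum.inl (i + 1) : VV) ∈ ea j ↔ j = i ∨ j = i + 1) ∧
    ((Sum.inl (i + 1) : VV) ∉ eb j) ∧ ((Sum.inl (i + 1) : VV) ∈ es j ↔ j = i + 1) ∧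
    ((Sum.inr (i + 1) : VV) ∈ eb j ↔ j = i ∨ j = i + 1) ∧
    ((Sum.inr (i + 1) : VV) ∉ ea j) ∧ ((Sum.inr (i + 1) : VV) ∈ es j ↔ j = i + 1) := by
  decide +kernel

lemma edges_ne : ∀ i j : ZMod 6, ea i ≠ eb j ∧ ea i ≠ es j ∧ eb i ≠ es j ∧
    (ea i = ea j ↔ i = j) ∧ (eb i = eb j ↔ i = j) ∧ (es i = es j ↔ i = j) := by
  decide +kernel

lemma succ_ne : ∀ i : ZMod 6, i ≠ i + 1 := by decide

/-- Exactly one edge of a perfect matching at `a_{i+1}`. -/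
lemma local_a {M : Set (Sym2 VV)} (hM : IsPM Annulus M) (i : ZMod 6) :
    (ea i ∈ M ∨ ea (i + 1) ∈ M ∨ es (i + 1) ∈ M) ∧ ¬ (ea i ∈ M ∧ ea (i + 1) ∈ M) ∧
    ¬ (ea i ∈ M ∧ es (i + 1) ∈ M) ∧ ¬ (ea (i + 1) ∈ M ∧ es (i + 1) ∈ M) := by
  obtain ⟨hs, hd, hc⟩ := hM
  have m1 := (mem_inl_iff i i).1.2 (Or.inl rfl)
  have m2 := (mem_inl_iff i (i + 1)).1.2 (Or.inr rfl)
  have m3 := (mem_inl_iff i (i + 1)).2.2.1.2 rfl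
  refine ⟨?_, fun h => hd _ h.1 _ h.2 ?_ _ ⟨m1, m2⟩, fun h => hd _ h.1 _ h.2 ?_ _ ⟨m1, m3⟩,
    fun h => hd _ h.1 _ h.2 ?_ _ ⟨m2, m3⟩⟩
  · obtain ⟨e, he, hv⟩ := hc (Sum.inl (i + 1))
    rcases edge_cases e (hs he) with ⟨j, rfl⟩ | ⟨j, rfl⟩ | ⟨j, rfl⟩
    · rcases (mem_inl_iff i j).1.1 hv with rfl | rfl <;> tauto
    · exact absurd hv (mem_inl_iff i j).2.1
    · have := (mem_inl_iff i j).2.2.1.1 hv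
      subst this; tauto
  · rw [Ne, (edges_ne _ _).2.2.2.1]; exact succ_ne i
  · exact (edges_ne _ _).2.1
  · exact (edges_ne _ _).2.1

/-- Exactly one edge of a perfect matching at `b_{i+1}`. -/
lemma local_b {M : Set (Sym2 VV)} (hM : IsPM Annulus M) (i : ZMod 6) :
    (eb i ∈ M ∨ eb (i + 1) ∈ M ∨ es (i + 1) ∈ M) ∧ ¬ (eb i ∈ M ∧ eb (i + 1) ∈ M) ∧
    ¬ (eb i ∈ M ∧ es (i + 1) ∈ M) ∧ ¬ (eb (i + 1) ∈ M ∧ es (i + 1) ∈ M) := by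
  obtain ⟨hs, hd, hc⟩ := hM
  have m1 := (mem_inl_iff i i).2.2.2.1.2 (Or.inl rfl)
  have m2 := (mem_inl_iff i (i + 1)).2.2.2.1.2 (Or.inr rfl)
  have m3 := (mem_inl_iff i (i + 1)).2.2.2.2.2.2 rfl
  refine ⟨?_, fun h => hd _ h.1 _ h.2 ?_ _ ⟨m1, m2⟩, fun h => hd _ h.1 _ h.2 ?_ _ ⟨m1, m3⟩,
    fun h => hd _ h.1 _ h.2 ?_ _ ⟨m2, m3⟩⟩
  · obtain ⟨e, he, hv⟩ := hc (Sum.inr (i + 1))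
    rcases edge_cases e (hs he) with ⟨j, rfl⟩ | ⟨j, rfl⟩ | ⟨j, rfl⟩
    · exact absurd hv (mem_inl_iff i j).2.2.2.2.1
    · rcases (mem_inl_iff i j).2.2.2.1.1 hv with rfl | rfl <;> tauto
    · have := (mem_inl_iff i j).2.2.2.2.2.1 hv
      subst this; tauto
  · rw [Ne, (edges_ne _ _).2.2.2.2.1]; exact succ_ne i
  · exact (edges_ne _ _).2.2.1
  · exact (edges_ne _ _).2.2.1

lemma pm_ext' {M N : Set (Sym2 VV)} (hM : IsPM Annulus M) (hN : IsPM Annulus N)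
    (ha : ∀ i, ea i ∈ M ↔ ea i ∈ N) (hb : ∀ i, eb i ∈ M ↔ eb i ∈ N) : M = N := by
  refine pm_ext hM hN ha hb fun i => ?_
  have h1 := local_a hM (i - 1)
  have h2 := local_a hN (i - 1)
  rw [sub_add_cancel] at h1 h2
  have := ha i
  have := ha (i - 1)
  grind

/-- The pattern `X` on the outer hexagon, complement on the inner one, propagates. -/
lemma propagate {M : Set (Sym2 VV)} (hM : IsPM Annulus M) (i : ZMod 6)
    (h : ea i ∈ M ∧ eb i ∉ M) : ea (i + 1) ∉ M ∧ eb (i + 1) ∈ M := by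
  have h1 := local_a hM i
  have h2 := local_b hM i
  grind

lemma propagate' {M : Set (Sym2 VV)} (hM : IsPM Annulus M) (i : ZMod 6)
    (h : ea i ∉ M ∧ eb i ∈ M) : ea (i + 1) ∈ M ∧ eb (i + 1) ∉ M := by
  have h1 := local_a hM i
  have h2 := local_b hM i
  grind

lemma N1_pattern : ∀ i : ZMod 6, (ea i ∈ FN1 ↔ i ∈ ({0, 2, 4} : Finset (ZMod 6))) ∧
    (eb i ∈ FN1 ↔ i ∈ ({1, 3, 5} : Finset (ZMod 6))) := by decide +kernel

lemma N2_pattern : ∀ i : ZMod 6, (ea i ∈ FN2 ↔ i ∈ ({1, 3, 5} : Finset (ZMod 6))) ∧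
    (eb i ∈ FN2 ↔ i ∈ ({0, 2, 4} : Finset (ZMod 6))) := by decide +kernel

lemma zmod6_cases : ∀ i : ZMod 6, i = 0 ∨ i = 1 ∨ i = 2 ∨ i = 3 ∨ i = 4 ∨ i = 5 := by decide

/-- If some outer edge is used without its inner twin, the matching is `N₁` or `N₂`. -/
lemma twist {M : Set (Sym2 VV)} (hM : IsPM Annulus M) (h0 : ea 0 ∈ M ∧ eb 0 ∉ M) :
    M = AnnulusN1 := by
  have h1 : ea 1 ∉ M ∧ eb 1 ∈ M := propagate hM 0 h0
  have h2 : ea 2 ∈ M ∧ eb 2 ∉ M := propagate' hM 1 h1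
  have h3 : ea 3 ∉ M ∧ eb 3 ∈ M := propagate hM 2 h2
  have h4 : ea 4 ∈ M ∧ eb 4 ∉ M := propagate' hM 3 h3
  have h5 : ea 5 ∉ M ∧ eb 5 ∈ M := propagate hM 4 h4
  refine pm_ext' hM pm_N1 (fun i => ?_) (fun i => ?_)
  · rw [mem_N1, (N1_pattern i).1]
    rcases zmod6_cases i with rfl | rfl | rfl | rfl | rfl | rfl <;> 
      simp only [h0, h1, h2, h3, h4, h5] <;> decide
  · rw [mem_N1, (N1_pattern i).2]
    rcases zmod6_cases i with rfl | rfl | rfl | rfl | rfl | rfl <;> 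
      simp only [h0, h1, h2, h3, h4, h5] <;> decide

lemma twist' {M : Set (Sym2 VV)} (hM : IsPM Annulus M) (h0 : ea 0 ∉ M ∧ eb 0 ∈ M) :
    M = AnnulusN2 := by
  have h1 : ea 1 ∈ M ∧ eb 1 ∉ M := propagate' hM 0 h0
  have h2 : ea 2 ∉ M ∧ eb 2 ∈ M := propagate hM 1 h1
  have h3 : ea 3 ∈ M ∧ eb 3 ∉ M := propagate' hM 2 h2
  have h4 : ea 4 ∉ M ∧ eb 4 ∈ M := propagate hM 3 h3
  have h5 : ea 5 ∈ M ∧ eb 5 ∉ M := propagate' hM 4 h4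
  refine pm_ext' hM pm_N2 (fun i => ?_) (fun i => ?_)
  · rw [mem_N2, (N2_pattern i).1]
    rcases zmod6_cases i with rfl | rfl | rfl | rfl | rfl | rfl <;> 
      simp only [h0, h1, h2, h3, h4, h5] <;> decide
  · rw [mem_N2, (N2_pattern i).2]
    rcases zmod6_cases i with rfl | rfl | rfl | rfl | rfl | rfl <;> 
      simp only [h0, h1, h2, h3, h4, h5] <;> decide

/-- Away from `N₁` and `N₂`, outer and inner edges come in pairs. -/
lemma paired {M : Set (Sym2 VV)} (hM : IsPM Annulus M) (n1 : M ≠ AnnulusN1)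
    (n2 : M ≠ AnnulusN2) : ∀ i, ea i ∈ M ↔ eb i ∈ M := by
  have step : ∀ i : ZMod 6, (ea i ∈ M ↔ eb i ∈ M) → (ea (i + 1) ∈ M ↔ eb (i + 1) ∈ M) := by
    intro i h
    have h1 := local_a hM i
    have h2 := local_b hM i
    grind
  have s0 : ea 0 ∈ M ↔ eb 0 ∈ M := by
    by_contra h
    have := mt (twist hM) n1
    have := mt (twist' hM) n2
    grind
  have s1 : ea 1 ∈ M ↔ eb 1 ∈ M := step 0 s0
  have s2 : ea 2 ∈ M ↔ eb 2 ∈ M := step 1 s1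
  have s3 : ea 3 ∈ M ↔ eb 3 ∈ M := step 2 s2
  have s4 : ea 4 ∈ M ↔ eb 4 ∈ M := step 3 s3
  have s5 : ea 5 ∈ M ↔ eb 5 ∈ M := step 4 s4
  intro i
  rcases zmod6_cases i with rfl | rfl | rfl | rfl | rfl | rfl <;> assumption

/-- Descent: every paired matching reaches every matching consisting of spokes only. -/
lemma descend (n : ℕ) : ∀ M : {M : Set (Sym2 VV) // IsPM Annulus M},
    (∀ i, ea i ∈ M.1 ↔ eb i ∈ M.1) → {i | ea i ∈ M.1}.ncard = n →
    ∃ S : {M : Set (Sym2 VV) // IsPM Annulus M},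
      (∀ i, ea i ∉ S.1 ∧ eb i ∉ S.1) ∧ (TransGraph Annulus).Reachable M S := by
  induction n with
  | zero =>
    intro M hp hn
    have he : {i | ea i ∈ M.1} = ∅ := (Set.ncard_eq_zero (Set.toFinite _)).1 hn
    have hno : ∀ i, ea i ∉ M.1 := fun i hi => by
      have : i ∈ {i | ea i ∈ M.1} := hi
      rw [he] at this; exact this
    exact ⟨M, fun i => ⟨hno i, fun h => hno i ((hp i).2 h)⟩, SimpleGraph.Reachable.refl _⟩
  | succ n ih =>
    intro M hp hn
    obtain ⟨i, hi⟩ : {i | ea i ∈ M.1}.Nonempty := by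
      rw [← Set.ncard_pos (Set.toFinite _)]; omega
    have hia : ea i ∈ M.1 := hi
    have hib : eb i ∈ M.1 := (hp i).1 hia
    have n1 : (i : ZMod 6) ≠ i + 1 := succ_ne i
    have e2 : s((Sum.inr (i + 1) : VV), Sum.inr i) ∈ M.1 := by
      rw [Sym2.eq_swap]; exact hib
    have a1 : Annulus.Adj (Sum.inr (i + 1)) (Sum.inl (i + 1)) := by
      rw [annulus_adj_iff]
    have a2 : Annulus.Adj (Sum.inl i) (Sum.inr i) := by
      rw [annulus_adj_iff]
    have hpm := switch_pm M.2 (u := Sum.inl i) (v := Sum.inl (i + 1)) (u' := Sum.inr (i + 1))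
      (v' := Sum.inr i) (by simp) (by simp) (by simp) (by simp) hia e2 a1 a2
    have hset : ((M.1 \ {s((Sum.inl i : VV), Sum.inl (i + 1)), s(Sum.inr (i + 1), Sum.inr i)}) ∪
        {s(Sum.inr (i + 1), Sum.inl (i + 1)), s(Sum.inl i, Sum.inr i)}) =
        (M.1 \ {ea i, eb i}) ∪ {es (i + 1), es i} := by
      rw [Sym2.eq_swap (a := (Sum.inr (i + 1) : VV)) (b := Sum.inr i),
        Sym2.eq_swap (a := (Sum.inr (i + 1) : VV)) (b := Sum.inl (i + 1))]
      rfl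
    have hsw : IsSwitch Annulus M.1 ((M.1 \ {ea i, eb i}) ∪ {es (i + 1), es i}) :=
      ⟨Sum.inl i, Sum.inl (i + 1), Sum.inr (i + 1), Sum.inr i, by simp [n1], by simp, by simp,
        by simp, by simp, by simp [n1.symm], hia, e2, a1, a2, hset.symm⟩
    rw [hset] at hpm
    have ma : ∀ j, ea j ∈ (M.1 \ {ea i, eb i}) ∪ {es (i + 1), es i} ↔ ea j ∈ M.1 ∧ j ≠ i := by
      intro j
      have p1 := edges_ne j i
      have p2 := edges_ne j (i + 1)
      simp only [Set.mem_union, Set.mem_sdiff, Set.mem_insert_iff, Set.mem_singleton_iff]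
      grind
    have mb : ∀ j, eb j ∈ (M.1 \ {ea i, eb i}) ∪ {es (i + 1), es i} ↔ eb j ∈ M.1 ∧ j ≠ i := by
      intro j
      have p1 := edges_ne j i
      have p2 := edges_ne j (i + 1)
      have p3 := (edges_ne i j).1.symm
      simp only [Set.mem_union, Set.mem_sdiff, Set.mem_insert_iff, Set.mem_singleton_iff]
      grind
    obtain ⟨S, hS, hr⟩ := ih ⟨_, hpm⟩ (fun j => by rw [ma, mb, hp j]) (by
      have : {j | ea j ∈ (M.1 \ {ea i, eb i}) ∪ {es (i + 1), es i}} = {j | ea j ∈ M.1} \ {i} := by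
        ext j
        exact ma j
      rw [this, Set.ncard_sdiff_singleton_of_mem hi, hn]; rfl)
    refine ⟨S, hS, SimpleGraph.Reachable.trans (SimpleGraph.Adj.reachable ?_) hr⟩
    unfold TransGraph
    rw [SimpleGraph.fromRel_adj]
    refine ⟨fun h => ?_, Or.inl hsw⟩
    have h' := congrArg Subtype.val h
    have : ea i ∈ (M.1 \ {ea i, eb i}) ∪ {es (i + 1), es i} := by
      have h2 : M.1 = (M.1 \ {ea i, eb i}) ∪ {es (i + 1), es i} := h'
      rw [← h2]; exact hia
    exact ((ma i).1 this).2 rfl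

/-- In the transition graph of the hexagonal annulus, the
perfect matchings `N₁` and `N₂` are isolated vertices (they admit no switch),
and all remaining perfect matchings lie in a single connected component. -/
theorem annulus_transGraph_structure :
    ∃ (h₁ : IsPM Annulus AnnulusN1) (h₂ : IsPM Annulus AnnulusN2),
      (∀ M : {M : Set (Sym2 (ZMod 6 ⊕ ZMod 6)) // IsPM Annulus M},
        ¬ (TransGraph Annulus).Adj ⟨AnnulusN1, h₁⟩ M) ∧
      (∀ M : {M : Set (Sym2 (ZMod 6 ⊕ ZMod 6)) // IsPM Annulus M},
        ¬ (TransGraph Annulus).Adj ⟨AnnulusN2, h₂⟩ M) ∧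
      (∀ M M' : {M : Set (Sym2 (ZMod 6 ⊕ ZMod 6)) // IsPM Annulus M},
        M.1 ≠ AnnulusN1 → M.1 ≠ AnnulusN2 → M'.1 ≠ AnnulusN1 → M'.1 ≠ AnnulusN2 →
          (TransGraph Annulus).Reachable M M') := by
  refine ⟨pm_N1, pm_N2, ?_, ?_, ?_⟩
  · exact isolated_of pm_N1 (by simp only [mem_N1]; exact noswitch_N1)
  · exact isolated_of pm_N2 (by simp only [mem_N2]; exact noswitch_N2)
  · intro M M' h1 h2 h3 h4
    obtain ⟨S, hS, hr⟩ := descend _ M (paired M.2 h1 h2) rfl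
    obtain ⟨T, hT, hr'⟩ := descend _ M' (paired M'.2 h3 h4) rfl
    have hST : S = T := Subtype.ext (pm_ext' S.2 T.2
      (fun i => iff_of_false (hS i).1 (hT i).1) (fun i => iff_of_false (hS i).2 (hT i).2))
    subst hST
    exact hr.trans hr'.symm
end

section
/- For every k ≥ 1, the transition graph 𝒢(W_k) of the spider's web graph W_k is connected. -/
/-- The spider's web graph `W_k` on the vertices `Fin k × ZMod 6` (vertex
`(i, j)` corresponds to `u_{i+1, j+1}`): `k` concentric hexagons joined by
spokes, plus the extra edge `u_{1,1}u_{1,4}`. -/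
def Web (k : ℕ) : SimpleGraph (Fin k × ZMod 6) :=
  SimpleGraph.fromRel fun x y =>
    (x.1 = y.1 ∧ y.2 = x.2 + 1) ∨
    (x.2 = y.2 ∧ (y.1 : ℕ) = (x.1 : ℕ) + 1) ∨
    ((x.1 : ℕ) = 0 ∧ (y.1 : ℕ) = 0 ∧ x.2 = 0 ∧ y.2 = 3)

/-- For `p ∈ {1, 2}`, the perfect matching `M_p` of `W_k` consisting of the
hexagon edges `u_{i,j}u_{i,j+1}` with `i + j ≡ p - 1 (mod 2)` (in the paper's
1-based indexing; here vertex `(i, j)` is `u_{i+1, j+1}`). -/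
def WebM (k p : ℕ) : Set (Sym2 (Fin k × ZMod 6)) :=
  {e | ∃ (i : Fin k) (j : ZMod 6),
    ((i : ℕ) + j.val) % 2 = (p - 1) % 2 ∧ e = s((i, j), (i, j + 1))}

/-- `x` and `y` are matched by `M`. -/
def Mt {V : Type*} {G : SimpleGraph V} (M : {M : Set (Sym2 V) // IsPM G M}) (x y : V) : Prop :=
  s(x, y) ∈ M.1

section general
variable {V : Type*} {G : SimpleGraph V}

theorem Mt.symm {M : {M : Set (Sym2 V) // IsPM G M}} {x y : V} (h : Mt M x y) : Mt M y x := by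
  unfold Mt at *; rwa [Sym2.eq_swap]

theorem Mt.adj {M : {M : Set (Sym2 V) // IsPM G M}} {x y : V} (h : Mt M x y) : G.Adj x y :=
  M.2.1 h

theorem Mt.uniq {M : {M : Set (Sym2 V) // IsPM G M}} {x y z : V} (h : Mt M x y)
    (h' : Mt M x z) : y = z := by
  by_contra hne
  refine M.2.2.1 _ h _ h' ?_ x ⟨by simp, by simp⟩
  intro he
  exact hne (Sym2.congr_right.1 he)

theorem Mt.exists (M : {M : Set (Sym2 V) // IsPM G M}) (x : V) : ∃ y, Mt M x y := by
  obtain ⟨e, he, hx⟩ := M.2.2.2 x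
  obtain ⟨y, rfl⟩ := Sym2.mem_iff_exists.1 hx
  exact ⟨y, he⟩

theorem pm_of {M : Set (Sym2 V)} (h1 : ∀ x y, s(x, y) ∈ M → G.Adj x y)
    (h2 : ∀ x y z, s(x, y) ∈ M → s(x, z) ∈ M → y = z) (h3 : ∀ x, ∃ y, s(x, y) ∈ M) :
    IsPM G M := by
  refine ⟨?_, ?_, ?_⟩
  · intro e
    induction e using Sym2.ind with
    | _ x y => exact h1 x y
  · rintro e he f hf hne v ⟨hv, hv'⟩
    obtain ⟨y, rfl⟩ := Sym2.mem_iff_exists.1 hv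
    obtain ⟨z, rfl⟩ := Sym2.mem_iff_exists.1 hv'
    exact hne (by rw [h2 v y z he hf])
  · intro v
    obtain ⟨y, hy⟩ := h3 v
    exact ⟨_, hy, by simp⟩

theorem flip_exists (M : {M : Set (Sym2 V) // IsPM G M}) {a b c d : V} (h1 : Mt M a b)
    (h2 : Mt M c d) (hac : a ≠ c) (had : G.Adj a d) (hcb : G.Adj c b) :
    ∃ M' : {M : Set (Sym2 V) // IsPM G M}, (TransGraph G).Reachable M M' ∧
      Mt M' a d ∧ Mt M' c b ∧
      ∀ x y, x ≠ a → x ≠ b → x ≠ c → x ≠ d → Mt M x y → Mt M' x y := by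
  have hab := h1.adj.ne
  have hcd := h2.adj.ne
  have had' := had.ne
  have hcb' := hcb.ne
  have hbd : b ≠ d := by
    rintro rfl
    exact hac (h1.symm.uniq h2.symm)
  have key : ∀ x y, s(x, y) ∈ (M.1 \ {s(a, b), s(c, d)}) ∪ {s(c, b), s(a, d)} ↔
      (Mt M x y ∧ x ≠ a ∧ x ≠ b ∧ x ≠ c ∧ x ≠ d) ∨ (x = c ∧ y = b) ∨ (x = b ∧ y = c) ∨
        (x = a ∧ y = d) ∨ (x = d ∧ y = a) := by
    intro x y
    have e1 : Mt M x y → (x = a → y = b) ∧ (x = b → y = a) ∧ (x = c → y = d) ∧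
        (x = d → y = c) := by
      intro h
      refine ⟨?_, ?_, ?_, ?_⟩ <;> rintro rfl
      · exact h.uniq h1
      · exact h.uniq h1.symm
      · exact h.uniq h2
      · exact h.uniq h2.symm
    simp only [Set.mem_union, Set.mem_diff, Set.mem_insert_iff, Set.mem_singleton_iff,
      Sym2.eq_iff]
    change (Mt M x y ∧ _) ∨ _ ↔ _
    by_cases hm : Mt M x y
    · have := e1 hm
      simp only [hm, true_and]
      grind
    · simp only [hm, false_and, false_or]
      grind
  have hpm : IsPM G ((M.1 \ {s(a, b), s(c, d)}) ∪ {s(c, b), s(a, d)}) := by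
    apply pm_of
    · intro x y h
      rw [key] at h
      rcases h with h | ⟨rfl, rfl⟩ | ⟨rfl, rfl⟩ | ⟨rfl, rfl⟩ | ⟨rfl, rfl⟩
      · exact h.1.adj
      · exact hcb
      · exact hcb.symm
      · exact had
      · exact had.symm
    · intro x y z h h'
      rw [key] at h h'
      have := @Mt.uniq V G M x y z
      grind
    · intro x
      obtain ⟨y, hy⟩ := Mt.exists M x
      simp only [key]
      by_cases x = a
      · exact ⟨d, by grind⟩
      by_cases x = b
      · exact ⟨c, by grind⟩
      by_cases x = c
      · exact ⟨b, by grind⟩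
      by_cases x = d
      · exact ⟨a, by grind⟩
      exact ⟨y, by grind⟩
  refine ⟨⟨_, hpm⟩, ?_, ?_, ?_, ?_⟩
  · by_cases he : M = ⟨_, hpm⟩
    · rw [← he]
    · apply SimpleGraph.Adj.reachable
      unfold TransGraph
      rw [SimpleGraph.fromRel_adj]
      refine ⟨he, Or.inl ⟨a, b, c, d, hab, hac, had', hcb'.symm, hbd, hcd, h1, h2, hcb, had, rfl⟩⟩
  · exact (key _ _).2 (by simp)
  · exact (key _ _).2 (by simp)
  · intro x y ha hb hc hd h
    exact (key _ _).2 (Or.inl ⟨h, ha, hb, hc, hd⟩)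

end general

/-- Perfect matchings of the web. -/
abbrev WPM (k : ℕ) := {M : Set (Sym2 (Fin k × ZMod 6)) // IsPM (Web k) M}

section web
variable {k : ℕ}

theorem z_succ_ne (j : ZMod 6) : j + 1 ≠ j := by revert j; decide

theorem adj_hex (i : Fin k) (j : ZMod 6) : (Web k).Adj (i, j) (i, j + 1) := by
  unfold Web
  rw [SimpleGraph.fromRel_adj]
  refine ⟨fun h => z_succ_ne j (Prod.ext_iff.1 h).2.symm, Or.inl (Or.inl ⟨rfl, rfl⟩)⟩

theorem adj_spoke {i i' : Fin k} (h : (i' : ℕ) = i + 1) (j : ZMod 6) :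
    (Web k).Adj (i, j) (i', j) := by
  unfold Web
  rw [SimpleGraph.fromRel_adj]
  refine ⟨fun h' => ?_, Or.inl (Or.inr (Or.inl ⟨rfl, h⟩))⟩
  have := (Prod.ext_iff.1 h').1
  simp only at this
  subst this
  omega

theorem adj_chord {i : Fin k} (h : (i : ℕ) = 0) : (Web k).Adj (i, 0) (i, 3) := by
  unfold Web
  rw [SimpleGraph.fromRel_adj]
  refine ⟨fun h' => ?_, Or.inl (Or.inr (Or.inr ⟨h, h, rfl, rfl⟩))⟩
  have this : (0 : ZMod 6) = 3 := (Prod.ext_iff.1 h').2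
  exact absurd this (by decide)

theorem web_cases (M : WPM k) (i : Fin k) (j : ZMod 6) :
    Mt M (i, j) (i, j + 1) ∨ Mt M (i, j - 1) (i, j) ∨
    (∃ i' : Fin k, (i' : ℕ) = i + 1 ∧ Mt M (i, j) (i', j)) ∨
    (∃ i' : Fin k, (i : ℕ) = i' + 1 ∧ Mt M (i', j) (i, j)) ∨
    ((i : ℕ) = 0 ∧ j = 0 ∧ Mt M (i, 0) (i, 3)) ∨ ((i : ℕ) = 0 ∧ j = 3 ∧ Mt M (i, 0) (i, 3)) := by
  obtain ⟨⟨i', j'⟩, hy⟩ := Mt.exists M (i, j)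
  have := hy.adj
  unfold Web at this
  rw [SimpleGraph.fromRel_adj] at this
  obtain ⟨-, (⟨h, h'⟩ | ⟨h, h'⟩ | ⟨h0, h1, h2, h3⟩) | (⟨h, h'⟩ | ⟨h, h'⟩ | ⟨h0, h1, h2, h3⟩)⟩ := this <;>
    simp only at *
  · subst h h'; exact Or.inl hy
  · subst h; exact Or.inr (Or.inr (Or.inl ⟨i', h', hy⟩))
  · obtain rfl : i = i' := Fin.ext (by omega)
    subst h2 h3
    simp [h0, hy]
  · subst h h'
    refine Or.inr (Or.inl ?_)
    rw [add_sub_cancel_right]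
    exact hy.symm
  · subst h; exact Or.inr (Or.inr (Or.inr (Or.inl ⟨i', h', hy.symm⟩)))
  · obtain rfl : i = i' := Fin.ext (by omega)
    subst h2 h3
    simp [h0, hy.symm]

/-- Lower end points of the spokes used. -/
def Tset (M : WPM k) : Set (Fin k × ZMod 6) :=
  {x | ∃ i' : Fin k, (i' : ℕ) = x.1 + 1 ∧ Mt M x (i', x.2)}

theorem T_back {M M' : WPM k} {a b c d : Fin k × ZMod 6}
    (h : ∀ x y, x ≠ a → x ≠ b → x ≠ c → x ≠ d → Mt M x y → Mt M' x y) :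
    ∀ x ∈ Tset M', x = a ∨ x = b ∨ x = c ∨ x = d ∨ x ∈ Tset M := by
  rintro x ⟨i', hi, hm⟩
  by_contra hcon
  push Not at hcon
  obtain ⟨h1, h2, h3, h4, h5⟩ := hcon
  obtain ⟨y, hy⟩ := Mt.exists M x
  have := (h x y h1 h2 h3 h4 hy).uniq hm
  subst this
  exact h5 ⟨i', hi, hy⟩

theorem not_T_of_hex {M : WPM k} {i : Fin k} {j j' : ZMod 6} (h : Mt M (i, j) (i, j')) :
    (i, j) ∉ Tset M := by
  rintro ⟨i', hi, hm⟩
  have := (Prod.ext_iff.1 (h.uniq hm)).1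
  simp only at this hi
  subst this
  omega

theorem not_T_of_top {M : WPM k} {i i' : Fin k} {j : ZMod 6} (hi : (i' : ℕ) = i + 1)
    (h : Mt M (i, j) (i', j)) :
    (i', j) ∉ Tset M := by
  rintro ⟨i'', hi', hm⟩
  have := (Prod.ext_iff.1 (h.symm.uniq hm)).1
  simp only at this hi'
  subst this
  omega

theorem down_flip (M : WPM k) {i i' : Fin k} (hi : (i' : ℕ) = i + 1) (j : ZMod 6)
    (h1 : Mt M (i, j) (i', j)) (h2 : Mt M (i, j + 1) (i', j + 1)) :
    ∃ M' : WPM k, (TransGraph (Web k)).Reachable M M' ∧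
      Tset M' ⊆ Tset M \ {(i, j), (i, j + 1)} ∧
      Mt M' (i, j) (i, j + 1) ∧ Mt M' (i', j) (i', j + 1) ∧
      (∀ x y, x ≠ (i, j) → x ≠ (i', j) → x ≠ (i, j + 1) → x ≠ (i', j + 1) → Mt M x y → Mt M' x y) := by
  have hj := z_succ_ne j
  obtain ⟨M', hr, ha, hb, hc⟩ := flip_exists M h1 h2.symm (by simp [hj.symm])
    (adj_hex i j) (adj_hex i' j).symm
  refine ⟨M', hr, ?_, ha, hb.symm, fun x y e1 e2 e3 e4 => hc x y e1 e2 e4 e3⟩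
  intro x hx
  have t1 := not_T_of_hex ha
  have t2 := not_T_of_hex ha.symm
  have t3 := not_T_of_hex hb
  have t4 := not_T_of_hex hb.symm
  have := T_back hc x hx
  simp only [Set.mem_diff, Set.mem_insert_iff, Set.mem_singleton_iff]
  grind

theorem up_flip (M : WPM k) {i i' : Fin k} (hi : (i' : ℕ) = i + 1) (j : ZMod 6)
    (h1 : Mt M (i, j) (i, j + 1)) (h2 : Mt M (i', j) (i', j + 1)) :
    ∃ M' : WPM k, (TransGraph (Web k)).Reachable M M' ∧
      Tset M' ⊆ Tset M ∪ {(i, j), (i, j + 1)} ∧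
      Mt M' (i, j) (i', j) ∧ Mt M' (i, j + 1) (i', j + 1) ∧
      (∀ x y, x ≠ (i, j) → x ≠ (i', j) → x ≠ (i, j + 1) → x ≠ (i', j + 1) → Mt M x y → Mt M' x y) := by
  have hj := z_succ_ne j
  have hne : i ≠ i' := by rintro rfl; omega
  obtain ⟨M', hr, ha, hb, hc⟩ := flip_exists M h1 h2.symm (by simp [hne])
    (adj_spoke hi j) (adj_spoke hi (j + 1)).symm
  refine ⟨M', hr, ?_, ha, hb.symm, fun x y e1 e2 e3 e4 => hc x y e1 e3 e4 e2⟩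
  intro x hx
  have t3 := not_T_of_top hi ha
  have t4 := not_T_of_top hi hb.symm
  have := T_back hc x hx
  simp only [Set.mem_union, Set.mem_insert_iff, Set.mem_singleton_iff]
  grind

theorem z_facts (j : ZMod 6) : j + 1 + 1 = j + 2 ∧ j + 2 + 1 = j + 3 ∧ j + 3 + 1 = j + 4 ∧
    j + 4 + 1 = j + 5 ∧ j + 5 + 1 = j ∧ j + 1 - 1 = j ∧ j + 2 - 1 = j + 1 ∧ j + 3 - 1 = j + 2 ∧
    j + 4 - 1 = j + 3 ∧ j + 5 - 1 = j + 4 ∧ j - 1 = j + 5 := by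
  revert j; decide

theorem z_ne (j : ZMod 6) : j ≠ j + 1 ∧ j ≠ j + 2 ∧ j ≠ j + 3 ∧ j ≠ j + 4 ∧ j ≠ j + 5 ∧
    j + 1 ≠ j + 2 ∧ j + 1 ≠ j + 3 ∧ j + 1 ≠ j + 4 ∧ j + 1 ≠ j + 5 ∧
    j + 2 ≠ j + 3 ∧ j + 2 ≠ j + 4 ∧ j + 2 ≠ j + 5 ∧ j + 3 ≠ j + 4 ∧ j + 3 ≠ j + 5 ∧
    j + 4 ≠ j + 5 := by
  revert j; decide

theorem z_chord (j : ZMod 6) : ¬ ((j + 1 = 0 ∨ j + 1 = 3) ∧ (j + 2 = 0 ∨ j + 2 = 3)) := by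
  revert j; decide

set_option maxHeartbeats 1000000 in
theorem reduce_step (M : WPM k) (hT : (Tset M).Nonempty) :
    ∃ M' : WPM k, (TransGraph (Web k)).Reachable M M' ∧ Tset M' ⊂ Tset M := by
  -- an adjacent pair of spokes suffices
  have easy : ∀ (i i' : Fin k) (j : ZMod 6), (i' : ℕ) = i + 1 → Mt M (i, j) (i', j) →
      Mt M (i, j + 1) (i', j + 1) →
      ∃ M' : WPM k, (TransGraph (Web k)).Reachable M M' ∧ Tset M' ⊂ Tset M := by
    intro i i' j hi h1 h2
    obtain ⟨M', hr, hs, -⟩ := down_flip M hi j h1 h2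
    refine ⟨M', hr, fun x hx => (hs hx).1, fun h => ?_⟩
    have := hs (h (show (i, j) ∈ Tset M from ⟨i', hi, h1⟩))
    simp at this
  by_contra hcon
  have noadj : ∀ (i i' : Fin k) (j : ZMod 6), (i' : ℕ) = i + 1 → Mt M (i, j) (i', j) →
      ¬ Mt M (i, j + 1) (i', j + 1) := fun i i' j h1 h2 h3 => hcon (easy i i' j h1 h2 h3)
  obtain ⟨⟨i, j⟩, hx, hmax⟩ := Set.exists_max_image (Tset M) (fun x => x.1) (Set.toFinite _) hT
  obtain ⟨i', hi, h0⟩ := hx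
  simp only at hi h0
  have hne : i ≠ i' := by rintro rfl; omega
  -- the layer above has no spokes upwards
  have top : ∀ l : ZMod 6, Mt M (i', l) (i', l + 1) ∨ Mt M (i', l - 1) (i', l) ∨
      Mt M (i, l) (i', l) := by
    intro l
    rcases web_cases M i' l with h | h | ⟨i2, h2, h⟩ | ⟨i2, h2, h⟩ | ⟨h, -⟩ | ⟨h, -⟩
    · exact Or.inl h
    · exact Or.inr (Or.inl h)
    · have := hmax (i', l) ⟨i2, h2, h⟩
      simp only [Fin.le_def] at this
      omega
    · obtain rfl : i = i2 := Fin.ext (by omega)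
      exact Or.inr (Or.inr h)
    · omega
    · omega
  obtain ⟨f1, f2, f3, f4, f5, g1, g2, g3, g4, g5, g0⟩ := z_facts j
  obtain ⟨n1, n2, n3, n4, n5, n12, n13, n14, n15, n23, n24, n25, n34, n35, n45⟩ := z_ne j
  have k1 := top (j + 1)
  have k3 := top (j + 3)
  have k5 := top (j + 5)
  simp only [f1, f2, f3, f4, f5, g1, g2, g3, g4, g5] at k1 k3 k5
  -- the first gap
  have a1 : Mt M (i', j + 1) (i', j + 2) := by
    rcases k1 with h | h | h
    · exact h
    · have := h0.symm.uniq h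
      simp [hne] at this
    · exact absurd h (noadj i i' j hi h0)
  have a3 : Mt M (i, j + 3) (i', j + 3) := by
    rcases k3 with h | h | h
    · exfalso
      rcases k5 with h' | h' | h'
      · have := h0.symm.uniq h'.symm
        simp [hne] at this
      · have := h.symm.uniq h'
        simp [n35] at this
      · have := noadj i i' (j + 5) hi h'
        rw [f5] at this
        exact this h0
    · have := h.uniq a1.symm
      simp [n13.symm] at this
    · exact h
  -- the layer below
  have b1 : Mt M (i, j + 1) (i, j + 2) := by
    by_contra hb
    have c1 := web_cases M i (j + 1)
    have c2 := web_cases M i (j + 2)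
    rw [f1, g1] at c1
    rw [f2, g2] at c2
    have c1' : (∃ i2 : Fin k, (i : ℕ) = i2 + 1 ∧ Mt M (i2, j + 1) (i, j + 1)) ∨
        ((i : ℕ) = 0 ∧ (j + 1 = 0 ∨ j + 1 = 3)) := by
      rcases c1 with h | h | ⟨i2, h2, h⟩ | h | h | h
      · exact absurd h hb
      · have := h0.uniq h
        simp [hne.symm] at this
      · obtain rfl : i' = i2 := Fin.ext (by omega)
        have := a1.uniq h.symm
        simp [hne.symm] at this
      · exact Or.inl h
      · exact Or.inr ⟨h.1, Or.inl h.2.1⟩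
      · exact Or.inr ⟨h.1, Or.inr h.2.1⟩
    have c2' : (∃ i2 : Fin k, (i : ℕ) = i2 + 1 ∧ Mt M (i2, j + 2) (i, j + 2)) ∨
        ((i : ℕ) = 0 ∧ (j + 2 = 0 ∨ j + 2 = 3)) := by
      rcases c2 with h | h | ⟨i2, h2, h⟩ | h | h | h
      · have := a3.uniq h.symm
        simp [hne.symm] at this
      · exact absurd h hb
      · obtain rfl : i' = i2 := Fin.ext (by omega)
        have := a1.symm.uniq h.symm
        simp [hne.symm] at this
      · exact Or.inl h
      · exact Or.inr ⟨h.1, Or.inl h.2.1⟩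
      · exact Or.inr ⟨h.1, Or.inr h.2.1⟩
    rcases c1' with ⟨i2, h2, h⟩ | ⟨h, h'⟩ <;> rcases c2' with ⟨i3, h3, h4⟩ | ⟨h3, h4⟩
    · obtain rfl : i2 = i3 := Fin.ext (by omega)
      have := noadj i2 i (j + 1) h2 h
      rw [f1] at this
      exact this h4
    · omega
    · omega
    · exact z_chord j ⟨h', h4⟩
  -- now flip up once and down twice
  rw [← f1] at a1 b1
  obtain ⟨M1, r1, t1, u1, v1, w1⟩ := up_flip M hi (j + 1) b1 a1
  rw [f1] at t1 v1 w1
  have p0 : Mt M1 (i, j) (i', j) := w1 _ _ (by simp [n1]) (by simp [n1]) (by simp [n2])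
    (by simp [n2]) h0
  have p3 : Mt M1 (i, j + 3) (i', j + 3) := w1 _ _ (by simp [n13.symm]) (by simp [n13.symm])
    (by simp [n23.symm]) (by simp [n23.symm]) a3
  obtain ⟨M2, r2, t2, u2, v2, w2⟩ := down_flip M1 hi j p0 u1
  have q2 : Mt M2 (i, j + 2) (i', j + 2) := w2 _ _ (by simp [n2.symm]) (by simp [n2.symm])
    (by simp [n12.symm]) (by simp [n12.symm]) v1
  have q3 : Mt M2 (i, j + 3) (i', j + 3) := w2 _ _ (by simp [n3.symm]) (by simp [n3.symm])
    (by simp [n13.symm]) (by simp [n13.symm]) p3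
  rw [← f2] at q3
  obtain ⟨M3, r3, t3, -⟩ := down_flip M2 hi (j + 2) q2 q3
  refine hcon ⟨M3, (r1.trans r2).trans r3, fun x hx => ?_, fun h => ?_⟩
  · have y1 := t3 hx
    have y2 := t2 y1.1
    have y3 := t1 y2.1
    have z1 := y1.2
    have z2 := y2.2
    simp only [Set.mem_union, Set.mem_insert_iff, Set.mem_singleton_iff] at y3 z1 z2
    rcases y3 with h | h | h
    · exact h
    · exact absurd (Or.inr h) z2
    · exact absurd (Or.inl h) z1
  · have := t2 (t3 (h (show (i, j) ∈ Tset M from ⟨i', hi, h0⟩))).1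
    simp at this

theorem reduce_all (M : WPM k) :
    ∃ M' : WPM k, (TransGraph (Web k)).Reachable M M' ∧ Tset M' = ∅ := by
  induction hn : (Tset M).ncard using Nat.strong_induction_on generalizing M with
  | _ n ih =>
    by_cases h : (Tset M).Nonempty
    · obtain ⟨M1, r1, h1⟩ := reduce_step M h
      obtain ⟨M2, r2, h2⟩ := ih _ (hn ▸ Set.ncard_lt_ncard h1 (Set.toFinite _)) M1 rfl
      exact ⟨M2, r1.trans r2, h2⟩
    · exact ⟨M, .refl _, Set.not_nonempty_iff_eq_empty.1 h⟩

/-- Layer `i` consists of the hexagon edges starting at `s`, `s+2`, `s+4`. -/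
def Lay (M : WPM k) (i : Fin k) (s : ZMod 6) : Prop :=
  Mt M (i, s) (i, s + 1) ∧ Mt M (i, s + 2) (i, s + 3) ∧ Mt M (i, s + 4) (i, s + 5)

/-- Every layer is a union of hexagon edges. -/
def Good (M : WPM k) : Prop := ∀ i, Lay M i 0 ∨ Lay M i 1

theorem lay_of_ne {M M' : WPM k} {S : Set (Fin k)}
    (h : ∀ x y, x.1 ∉ S → Mt M x y → Mt M' x y) {i : Fin k} (hi : i ∉ S) {s : ZMod 6}
    (hl : Lay M i s) : Lay M' i s :=
  ⟨h _ _ hi hl.1, h _ _ hi hl.2.1, h _ _ hi hl.2.2⟩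

/-- Layer zero, chord matching. -/
def Chd (M : WPM k) (i : Fin k) : Prop :=
  Mt M (i, 0) (i, 3) ∧ Mt M (i, 1) (i, 2) ∧ Mt M (i, 4) (i, 5)

set_option maxHeartbeats 1000000 in
theorem lay_cases (M : WPM k) (hT : Tset M = ∅) (i : Fin k) :
    Lay M i 0 ∨ Lay M i 1 ∨ ((i : ℕ) = 0 ∧ Chd M i) := by
  have c : ∀ l : ZMod 6, Mt M (i, l) (i, l + 1) ∨ Mt M (i, l - 1) (i, l) ∨
      ((i : ℕ) = 0 ∧ (l = 0 ∨ l = 3) ∧ Mt M (i, 0) (i, 3)) := by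
    intro l
    rcases web_cases M i l with h | h | ⟨i2, h2, h⟩ | ⟨i2, h2, h⟩ | ⟨h, h', h''⟩ | ⟨h, h', h''⟩
    · exact Or.inl h
    · exact Or.inr (Or.inl h)
    · exact absurd (show (i, l) ∈ Tset M from ⟨i2, h2, h⟩) (by simp [hT])
    · exact absurd (show (i2, l) ∈ Tset M from ⟨i, h2, h⟩) (by simp [hT])
    · exact Or.inr (Or.inr ⟨h, Or.inl h', h''⟩)
    · exact Or.inr (Or.inr ⟨h, Or.inr h', h''⟩)
  have U : ∀ a b c : ZMod 6, Mt M (i, a) (i, b) → Mt M (i, a) (i, c) → b = c :=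
    fun a b c h h' => (Prod.ext_iff.1 (h.uniq h')).2
  have Sy : ∀ a b : ZMod 6, Mt M (i, a) (i, b) → Mt M (i, b) (i, a) := fun a b h => h.symm
  generalize hP : (fun a b => Mt M (i, a) (i, b)) = P
  have hP' : ∀ a b, Mt M (i, a) (i, b) = P a b := fun a b => by rw [← hP]
  unfold Lay Chd
  simp only [hP'] at *
  have c0 := c 0
  have c1 := c 1
  have c2 := c 2
  have c3 := c 3
  have c4 := c 4
  have c5 := c 5
  clear c
  have e : ∀ a b c : ZMod 6, P a b → P a c → b ≠ c → False := fun a b c h h' hn => hn (U a b c h h')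
  clear U
  change P 0 1 ∨ P 5 0 ∨ _ at c0
  change P 1 2 ∨ P 0 1 ∨ _ at c1
  change P 2 3 ∨ P 1 2 ∨ _ at c2
  change P 3 4 ∨ P 2 3 ∨ _ at c3
  change P 4 5 ∨ P 3 4 ∨ _ at c4
  change P 5 0 ∨ P 4 5 ∨ _ at c5
  change (P 0 1 ∧ P 2 3 ∧ P 4 5) ∨ (P 1 2 ∧ P 3 4 ∧ P 5 0) ∨ _
  have m0 : P 0 1 → P 5 0 → False := fun h h' => e 0 1 5 h (Sy _ _ h') (by decide)
  have m1 : P 1 2 → P 0 1 → False := fun h h' => e 1 2 0 h (Sy _ _ h') (by decide)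
  have m2 : P 2 3 → P 1 2 → False := fun h h' => e 2 3 1 h (Sy _ _ h') (by decide)
  have m3 : P 3 4 → P 2 3 → False := fun h h' => e 3 4 2 h (Sy _ _ h') (by decide)
  have m4 : P 4 5 → P 3 4 → False := fun h h' => e 4 5 3 h (Sy _ _ h') (by decide)
  have m5 : P 5 0 → P 4 5 → False := fun h h' => e 5 0 4 h (Sy _ _ h') (by decide)
  have l0 : P 0 3 → P 0 1 → False := fun h h' => e 0 3 1 h h' (by decide)
  have l1 : P 0 3 → P 5 0 → False := fun h h' => e 0 3 5 h (Sy _ _ h') (by decide)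
  have l2 : P 0 3 → P 2 3 → False := fun h h' => e 3 0 2 (Sy _ _ h) (Sy _ _ h') (by decide)
  have l3 : P 0 3 → P 3 4 → False := fun h h' => e 3 0 4 (Sy _ _ h) h' (by decide)
  have d1 : ¬ ((1 : ZMod 6) = 0 ∨ (1 : ZMod 6) = 3) := by decide
  have d2 : ¬ ((2 : ZMod 6) = 0 ∨ (2 : ZMod 6) = 3) := by decide
  have d4 : ¬ ((4 : ZMod 6) = 0 ∨ (4 : ZMod 6) = 3) := by decide
  have d5 : ¬ ((5 : ZMod 6) = 0 ∨ (5 : ZMod 6) = 3) := by decide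
  clear e Sy
  simp only [d1, d2, d4, d5, false_and, and_false, or_false] at c1 c2 c4 c5
  rcases c0 with h | h | ⟨hi, -, h⟩
  · have h2 : P 2 3 := c2.resolve_right fun h' => m1 h' h
    have h4 : P 4 5 := c4.resolve_right fun h' => m3 h' h2
    exact Or.inl ⟨h, h2, h4⟩
  · have h1 : P 1 2 := c1.resolve_right fun h' => m0 h' h
    have h3 : P 3 4 := c4.resolve_left fun h' => m5 h h'
    exact Or.inr (Or.inl ⟨h1, h3, h⟩)
  · have h1 : P 1 2 := c1.resolve_right fun h' => l0 h h'
    have h4 : P 4 5 := c4.resolve_right fun h' => l3 h h'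
    exact Or.inr (Or.inr ⟨hi, h, h1, h4⟩)

theorem chd_to (M : WPM k) (i : Fin k) (hi : (i : ℕ) = 0) (h : Chd M i) (s : ZMod 6)
    (hs : s = 0 ∨ s = 1) :
    ∃ M' : WPM k, (TransGraph (Web k)).Reachable M M' ∧ Lay M' i s ∧
      ∀ x y, x.1 ∉ ({i} : Set (Fin k)) → Mt M x y → Mt M' x y := by
  obtain ⟨h1, h2, h3⟩ := h
  rcases hs with rfl | rfl
  · obtain ⟨M', r, a, b, c⟩ := flip_exists M h1 h2.symm (by simp; decide) (adj_hex i 0)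
      (adj_hex i 2)
    refine ⟨M', r, ⟨a, b, c _ _ ?_ ?_ ?_ ?_ h3⟩, fun x y hx => c x y ?_ ?_ ?_ ?_⟩
    iterate 4 (simp; try decide)
    all_goals (rintro rfl; simp at hx)
  · obtain ⟨M', r, a, b, c⟩ := flip_exists M h1 h3 (by simp; decide)
      (adj_hex i 5).symm (adj_hex i 3).symm
    refine ⟨M', r, ⟨c _ _ ?_ ?_ ?_ ?_ h2, b.symm, a.symm⟩, fun x y hx => c x y ?_ ?_ ?_ ?_⟩
    iterate 4 (simp; try decide)
    all_goals (rintro rfl; simp at hx)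

theorem to_chd (M : WPM k) (i : Fin k) (hi : (i : ℕ) = 0) (s : ZMod 6)
    (hs : s = 0 ∨ s = 1) (h : Lay M i s) :
    ∃ M' : WPM k, (TransGraph (Web k)).Reachable M M' ∧ Chd M' i ∧
      ∀ x y, x.1 ∉ ({i} : Set (Fin k)) → Mt M x y → Mt M' x y := by
  obtain ⟨h1, h2, h3⟩ := h
  rcases hs with rfl | rfl
  · change Mt M (i, 0) (i, 1) at h1
    change Mt M (i, 2) (i, 3) at h2
    change Mt M (i, 4) (i, 5) at h3
    obtain ⟨M', r, a, b, c⟩ := flip_exists M h1 h2 (by simp; decide) (adj_chord hi)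
      (adj_hex i 1).symm
    refine ⟨M', r, ⟨a, b.symm, c _ _ ?_ ?_ ?_ ?_ h3⟩, fun x y hx => c x y ?_ ?_ ?_ ?_⟩
    iterate 4 (simp; try decide)
    all_goals (rintro rfl; simp at hx)
  · change Mt M (i, 1) (i, 2) at h1
    change Mt M (i, 3) (i, 4) at h2
    change Mt M (i, 5) (i, 0) at h3
    obtain ⟨M', r, a, b, c⟩ := flip_exists M h2 h3 (by simp; decide) (adj_chord hi).symm
      (adj_hex i 4).symm
    refine ⟨M', r, ⟨a.symm, c _ _ ?_ ?_ ?_ ?_ h1, b.symm⟩, fun x y hx => c x y ?_ ?_ ?_ ?_⟩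
    iterate 4 (simp; try decide)
    all_goals (rintro rfl; simp at hx)

theorem two_layers (M : WPM k) {i i' : Fin k} (hi : (i' : ℕ) = i + 1) (s : ZMod 6)
    (h : Lay M i s) (h' : Lay M i' s) :
    ∃ M' : WPM k, (TransGraph (Web k)).Reachable M M' ∧ Lay M' i (s + 1) ∧ Lay M' i' (s + 1) ∧
      ∀ x y, x.1 ∉ ({i, i'} : Set (Fin k)) → Mt M x y → Mt M' x y := by
  obtain ⟨f1, f2, f3, f4, f5, -⟩ := z_facts s
  obtain ⟨n1, n2, n3, n4, n5, n12, n13, n14, n15, n23, n24, n25, n34, n35, n45⟩ := z_ne s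
  have w2 : s + 1 + 2 = s + 3 := by ring
  have w3 : s + 1 + 3 = s + 4 := by ring
  have w4 : s + 1 + 4 = s + 5 := by ring
  have w5 : s + 1 + 5 = s := by rw [show s + 1 + 5 = s + 5 + 1 by ring, f5]
  unfold Lay at *
  rw [f1, w2, w3, w4, w5]
  obtain ⟨a1, a2, a3⟩ := h
  obtain ⟨b1, b2, b3⟩ := h'
  obtain ⟨M1, r1, -, p0, p1, c1⟩ := up_flip M hi s a1 b1
  obtain ⟨M2, r2, -, p2, p3, c2⟩ := up_flip M1 hi (s + 2)
    (by rw [f2]; apply c1 <;> simp [*, n2.symm, n12.symm])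
    (by rw [f2]; apply c1 <;> simp [*, n2.symm, n12.symm])
  rw [f2] at p3 c2
  obtain ⟨M3, r3, -, p4, p5, c3⟩ := up_flip M2 hi (s + 4)
    (by rw [f4]; apply c2 <;> first | simp [n24.symm, n34.symm]; done | (apply c1 <;> simp [*, n4.symm, n14.symm]))
    (by rw [f4]; apply c2 <;> first | simp [n24.symm, n34.symm]; done | (apply c1 <;> simp [*, n4.symm, n14.symm]))
  rw [f4] at p5 c3
  have P2 : Mt M3 (i, s + 2) (i', s + 2) := by apply c3 <;> simp [*]
  have P3 : Mt M3 (i, s + 3) (i', s + 3) := by apply c3 <;> simp [*]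
  have P0 : Mt M3 (i, s) (i', s) := by
    apply c3 <;> first | simp [n4, n5]; done | (apply c2 <;> simp [*])
  have P1 : Mt M3 (i, s + 1) (i', s + 1) := by
    apply c3 <;> first | simp [n14, n15]; done | (apply c2 <;> simp [*])
  obtain ⟨M4, r4, -, x1, y1, c4⟩ := down_flip M3 hi (s + 1) P1 (by rw [f1]; exact P2)
  rw [f1] at x1 y1 c4
  obtain ⟨M5, r5, -, x3, y3, c5⟩ := down_flip M4 hi (s + 3)
    (by apply c4 <;> simp [P3, n13.symm, n23.symm])
    (by rw [f3]; apply c4 <;> simp [p4, n14.symm, n24.symm])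
  rw [f3] at x3 y3 c5
  obtain ⟨M6, r6, -, x5, y5, c6⟩ := down_flip M5 hi (s + 5)
    (by apply c5 <;> first | simp [n35.symm, n45.symm]; done | (apply c4 <;> simp [p5, n15.symm, n25.symm]))
    (by rw [f5]; apply c5 <;> first | simp [n3, n4]; done | (apply c4 <;> simp [P0, n1, n2]))
  rw [f5] at x5 y5 c6
  refine ⟨M6, ((((r1.trans r2).trans r3).trans r4).trans r5).trans r6, ⟨?_, ?_, x5⟩, ⟨?_, ?_, y5⟩, ?_⟩
  · apply c6 <;> first | simp [n15, n1.symm]; done | (apply c5 <;> simp [x1, n13, n14])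
  · apply c6 <;> simp [x3, n35, n3.symm]
  · apply c6 <;> first | simp [n15, n1.symm]; done | (apply c5 <;> simp [y1, n13, n14])
  · apply c6 <;> simp [y3, n35, n3.symm]
  · rintro ⟨x, l⟩ y hx hm
    simp only [Set.mem_insert_iff, Set.mem_singleton_iff, not_or] at hx
    apply c6 <;> try simp [hx]
    apply c5 <;> try simp [hx]
    apply c4 <;> try simp [hx]
    apply c3 <;> try simp [hx]
    apply c2 <;> try simp [hx]
    apply c1 <;> simp [hx, hm]

theorem set_layer (n : ℕ) (hn : n < k) (M : WPM k) (hM : Good M) (s : ZMod 6)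
    (hs : s = 0 ∨ s = 1) :
    ∃ M' : WPM k, (TransGraph (Web k)).Reachable M M' ∧ Good M' ∧ Lay M' ⟨n, hn⟩ s ∧
      ∀ i : Fin k, n < i → ∀ t, Lay M i t → Lay M' i t := by
  induction n generalizing M s with
  | zero =>
    obtain ⟨s', hs', hl⟩ : ∃ s', (s' = 0 ∨ s' = 1) ∧ Lay M ⟨0, hn⟩ s' := by
      rcases hM ⟨0, hn⟩ with h | h
      · exact ⟨0, by simp, h⟩
      · exact ⟨1, by simp, h⟩
    obtain ⟨M1, r1, h1, c1⟩ := to_chd M ⟨0, hn⟩ rfl s' hs' hl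
    obtain ⟨M2, r2, h2, c2⟩ := chd_to M1 ⟨0, hn⟩ rfl h1 s hs
    have key : ∀ i : Fin k, i ≠ ⟨0, hn⟩ → ∀ t, Lay M i t → Lay M2 i t := fun i hi t h =>
      lay_of_ne c2 (by simpa using hi) (lay_of_ne c1 (by simpa using hi) h)
    refine ⟨M2, r1.trans r2, ?_, h2, ?_⟩
    · intro i
      by_cases hi : i = ⟨0, hn⟩
      · subst hi
        rcases hs with rfl | rfl
        · exact Or.inl h2
        · exact Or.inr h2
      · exact (hM i).imp (key i hi 0) (key i hi 1)
    · intro i hi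
      apply key
      rintro rfl
      simp at hi
  | succ n ih =>
    by_cases hl : Lay M ⟨n + 1, hn⟩ s
    · exact ⟨M, .refl _, hM, hl, fun _ _ _ h => h⟩
    obtain ⟨s', hs', hl', hss⟩ : ∃ s' : ZMod 6, (s' = 0 ∨ s' = 1) ∧ Lay M ⟨n + 1, hn⟩ s' ∧
        ((s = s' + 1) ∨ (s' = 1 ∧ s = 0)) := by
      rcases hs with rfl | rfl
      · exact ⟨1, by simp, (hM _).resolve_left hl, by simp⟩
      · exact ⟨0, by simp, (hM _).resolve_right hl, by simp⟩
    obtain ⟨M1, r1, g1, l1, k1⟩ := ih (by omega) M hM s' hs'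
    have l1' := k1 ⟨n + 1, hn⟩ (by simp) s' hl'
    obtain ⟨M2, r2, a, b, c⟩ := two_layers M1 (i := ⟨n, by omega⟩) (i' := ⟨n + 1, hn⟩) rfl s' l1 l1'
    have conv : ∀ i, Lay M2 i (s' + 1) → Lay M2 i s := by
      intro i hh
      rcases hss with rfl | ⟨rfl, rfl⟩
      · exact hh
      · obtain ⟨u1, u2, u3⟩ := hh
        exact ⟨u3, u1, u2⟩
    have a := conv _ a
    have b := conv _ b
    have key : ∀ i : Fin k, i ≠ ⟨n, by omega⟩ → i ≠ ⟨n + 1, hn⟩ → ∀ t, Lay M1 i t → Lay M2 i t :=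
      fun i hi hi' t h => lay_of_ne c (by simp [hi, hi']) h
    have good : ∀ i, Lay M2 i s → Lay M2 i 0 ∨ Lay M2 i 1 := by
      intro i h
      rcases hs with rfl | rfl
      · exact Or.inl h
      · exact Or.inr h
    refine ⟨M2, r1.trans r2, ?_, b, ?_⟩
    · intro i
      by_cases hi : i = ⟨n, by omega⟩
      · subst hi; exact good _ a
      by_cases hi' : i = ⟨n + 1, hn⟩
      · subst hi'; exact good _ b
      exact (g1 i).imp (key i hi hi' 0) (key i hi hi' 1)
    · intro i hi t h
      refine key i ?_ ?_ t (k1 i (by omega) t h)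
      · rintro rfl; simp at hi
      · rintro rfl; simp at hi

theorem to_good (M : WPM k) : ∃ M' : WPM k, (TransGraph (Web k)).Reachable M M' ∧ Good M' := by
  obtain ⟨M1, r1, h1⟩ := reduce_all M
  by_cases hc : ∃ i : Fin k, (i : ℕ) = 0 ∧ Chd M1 i
  · obtain ⟨i, hi, hc⟩ := hc
    obtain ⟨M2, r2, h2, c2⟩ := chd_to M1 i hi hc 0 (Or.inl rfl)
    refine ⟨M2, r1.trans r2, fun i' => ?_⟩
    by_cases he : i' = i
    · subst he; exact Or.inl h2
    · rcases lay_cases M1 h1 i' with h | h | h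
      · exact Or.inl (lay_of_ne c2 (by simpa using he) h)
      · exact Or.inr (lay_of_ne c2 (by simpa using he) h)
      · exact absurd (Fin.ext (by omega)) he
  · refine ⟨M1, r1, fun i => ?_⟩
    rcases lay_cases M1 h1 i with h | h | h
    · exact Or.inl h
    · exact Or.inr h
    · exact absurd ⟨i, h⟩ hc

theorem to_A (M : WPM k) :
    ∃ M' : WPM k, (TransGraph (Web k)).Reachable M M' ∧ ∀ i, Lay M' i 0 := by
  have : ∀ m ≤ k, ∃ M' : WPM k, (TransGraph (Web k)).Reachable M M' ∧ Good M' ∧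
      ∀ i : Fin k, k - m ≤ i → Lay M' i 0 := by
    intro m
    induction m with
    | zero =>
      intro _
      obtain ⟨M1, r, g⟩ := to_good M
      exact ⟨M1, r, g, fun i hi => by omega⟩
    | succ m ih =>
      intro hm
      obtain ⟨M1, r, g, l⟩ := ih (by omega)
      obtain ⟨M2, r2, g2, l2, c⟩ := set_layer (k - (m + 1)) (by omega) M1 g 0 (Or.inl rfl)
      refine ⟨M2, r.trans r2, g2, fun i hi => ?_⟩
      rcases hi.eq_or_lt with h | h
      · convert l2
        exact h.symm
      · exact c i h 0 (l i (by omega))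
  obtain ⟨M', r, -, h⟩ := this k le_rfl
  exact ⟨M', r, fun i => h i (by omega)⟩

theorem z_all (j : ZMod 6) : j = 0 ∨ j = 1 ∨ j = 2 ∨ j = 3 ∨ j = 4 ∨ j = 5 := by
  revert j; decide

theorem A_le (M N : WPM k) (hM : ∀ i, Lay M i 0) (hN : ∀ i, Lay N i 0) : M.1 ⊆ N.1 := by
  intro e
  induction e using Sym2.ind with
  | _ x y =>
    intro h
    change Mt M x y at h
    change Mt N x y
    obtain ⟨i, j⟩ := x
    obtain ⟨a1, a2, a3⟩ := hM i
    obtain ⟨b1, b2, b3⟩ := hN i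
    rcases z_all j with rfl | rfl | rfl | rfl | rfl | rfl
    · rw [h.uniq a1]; exact b1
    · rw [h.uniq a1.symm]; exact b1.symm
    · rw [h.uniq a2]; exact b2
    · rw [h.uniq a2.symm]; exact b2.symm
    · rw [h.uniq a3]; exact b3
    · rw [h.uniq a3.symm]; exact b3.symm

/-- Partner in the standard hexagon matching. -/
def prt (j : ZMod 6) : ZMod 6 := if j.val % 2 = 0 then j + 1 else j - 1

theorem prt_prt (j : ZMod 6) : prt (prt j) = j := by revert j; decide

theorem prt_or (j : ZMod 6) : prt j = j + 1 ∨ j = prt j + 1 := by revert j; decide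

theorem pm_exists (k : ℕ) : Nonempty (WPM k) := by
  have key : ∀ x y : Fin k × ZMod 6,
      s(x, y) ∈ {e : Sym2 (Fin k × ZMod 6) | ∃ i j, e = s((i, j), (i, prt j))} ↔
        y = (x.1, prt x.2) := by
    intro x y
    constructor
    · rintro ⟨i, j, h⟩
      rw [Sym2.eq_iff] at h
      rcases h with ⟨rfl, rfl⟩ | ⟨rfl, rfl⟩
      · rfl
      · simp [prt_prt]
    · rintro rfl
      exact ⟨x.1, x.2, rfl⟩
  refine ⟨⟨_, pm_of (G := Web k) (M := {e | ∃ i j, e = s((i, j), (i, prt j))}) ?_ ?_ ?_⟩⟩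
  · intro x y h
    rw [key] at h
    subst h
    rcases prt_or x.2 with h | h
    · rw [h]; exact adj_hex _ _
    · have := (adj_hex x.1 (prt x.2)).symm
      rw [← h] at this
      exact this
  · intro x y z h h'
    rw [key] at h h'
    rw [h, h']
  · intro x
    exact ⟨_, (key _ _).2 rfl⟩

end web

/-- For every `k ≥ 1`, the transition graph of the spider's
web graph `W_k` is connected. -/
theorem web_transGraph_connected (k : ℕ) (hk : 1 ≤ k) :
    (TransGraph (Web k)).Connected := by
  have := pm_exists k
  refine SimpleGraph.Connected.mk ?_
  intro M N
  obtain ⟨M', rM, hM⟩ := to_A M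
  obtain ⟨N', rN, hN⟩ := to_A N
  have : M' = N' := Subtype.ext (Set.Subset.antisymm (A_le _ _ hM hN) (A_le _ _ hN hM))
  subst this
  exact rM.trans rN.symm
end

section
/- For every k ≥ 1, the distance between the perfect matchings M₁ and M₂ in the transition graph 𝒢(W_k) of the spider's web W_k is exactly k(3k − 1). -/
/-! ### Step counting -/

inductive Steps {V : Type*} (G : SimpleGraph V) : ℕ → Set (Sym2 V) → Set (Sym2 V) → Prop
  | refl (M : Set (Sym2 V)) : Steps G 0 M M
  | cons {n : ℕ} {M M' M'' : Set (Sym2 V)} :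
      IsSwitch G M M' → Steps G n M' M'' → Steps G (n + 1) M M''

theorem Steps.trans {V : Type*} {G : SimpleGraph V} {m n : ℕ} {A B C : Set (Sym2 V)}
    (h : Steps G m A B) (h' : Steps G n B C) : Steps G (m + n) A C := by
  induction h with
  | refl M => simpa using h'
  | cons hs _ ih =>
    have := Steps.cons hs (ih h')
    rwa [Nat.add_right_comm] at this

theorem IsPM.switch {V : Type*} {G : SimpleGraph V} {M M' : Set (Sym2 V)}
    (h : IsPM G M) (hs : IsSwitch G M M') : IsPM G M' := by
  obtain ⟨u, v, u', v', h1, h2, h3, h4, h5, h6, hm, hm', ha, ha', rfl⟩ := hs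
  obtain ⟨hsub, hdis, hcov⟩ := h
  have key : ∀ e ∈ M, e ≠ s(u, v) → e ≠ s(u', v') → u ∉ e ∧ v ∉ e ∧ u' ∉ e ∧ v' ∉ e := by
    intro e he he1 he2
    refine ⟨fun hx => ?_, fun hx => ?_, fun hx => ?_, fun hx => ?_⟩
    · exact hdis e he _ hm he1 u ⟨hx, by simp⟩
    · exact hdis e he _ hm he1 v ⟨hx, by simp⟩
    · exact hdis e he _ hm' he2 u' ⟨hx, by simp⟩
    · exact hdis e he _ hm' he2 v' ⟨hx, by simp⟩
  refine ⟨?_, ?_, ?_⟩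
  · rintro e (⟨he, -⟩ | rfl | rfl)
    · exact hsub he
    · exact ha
    · exact ha'
  · rintro e (⟨he, hne⟩ | rfl | rfl) f (⟨hf, hnf⟩ | rfl | rfl) hef w ⟨hw1, hw2⟩
    · exact hdis e he f hf hef w ⟨hw1, hw2⟩
    · simp only [Set.mem_insert_iff, Set.mem_singleton_iff, not_or] at hne
      have := key e he hne.1 hne.2
      rcases Sym2.mem_iff.1 hw2 with rfl | rfl <;> tauto
    · simp only [Set.mem_insert_iff, Set.mem_singleton_iff, not_or] at hne
      have := key e he hne.1 hne.2
      rcases Sym2.mem_iff.1 hw2 with rfl | rfl <;> tauto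
    · simp only [Set.mem_insert_iff, Set.mem_singleton_iff, not_or] at hnf
      have := key f hf hnf.1 hnf.2
      rcases Sym2.mem_iff.1 hw1 with rfl | rfl <;> tauto
    · exact hef rfl
    · rcases Sym2.mem_iff.1 hw1 with rfl | rfl <;>
      rcases Sym2.mem_iff.1 hw2 with rfl | rfl <;> tauto
    · simp only [Set.mem_insert_iff, Set.mem_singleton_iff, not_or] at hnf
      have := key f hf hnf.1 hnf.2
      rcases Sym2.mem_iff.1 hw1 with rfl | rfl <;> tauto
    · rcases Sym2.mem_iff.1 hw1 with rfl | rfl <;>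
      rcases Sym2.mem_iff.1 hw2 with rfl | rfl <;> tauto
    · exact hef rfl
  · intro w
    obtain ⟨e, he, hw⟩ := hcov w
    by_cases e1 : e = s(u, v)
    · subst e1
      rcases Sym2.mem_iff.1 hw with rfl | rfl
      · exact ⟨s(w, v'), by simp, by simp⟩
      · exact ⟨s(u', w), by simp, by simp⟩
    by_cases e2 : e = s(u', v')
    · subst e2
      rcases Sym2.mem_iff.1 hw with rfl | rfl
      · exact ⟨s(w, v), by simp, by simp⟩
      · exact ⟨s(u, w), by simp, by simp⟩
    exact ⟨e, Or.inl ⟨he, by simp [e1, e2]⟩, hw⟩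

theorem Steps.walk {V : Type*} {G : SimpleGraph V} {n : ℕ} {A B : Set (Sym2 V)}
    (h : Steps G n A B) : ∀ hA : IsPM G A, ∃ hB : IsPM G B,
      ∃ p : (TransGraph G).Walk ⟨A, hA⟩ ⟨B, hB⟩, p.length ≤ n := by
  induction h with
  | refl M => exact fun hA => ⟨hA, .nil, by simp⟩
  | @cons n M M' M'' hs _ ih =>
    intro hA
    obtain ⟨hB, p, hp⟩ := ih (hA.switch hs)
    refine ⟨hB, ?_⟩
    by_cases hne : M = M'
    · subst hne
      exact ⟨p, by omega⟩
    · have hadj : (TransGraph G).Adj ⟨M, hA⟩ ⟨M', hA.switch hs⟩ := by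
        rw [TransGraph, SimpleGraph.fromRel_adj]
        exact ⟨fun h => hne (congrArg Subtype.val h), Or.inl hs⟩
      exact ⟨.cons hadj p, by simpa using hp⟩

theorem IsSwitch.lift {A V : Type*} {P : SimpleGraph A} {G : SimpleGraph V} (φ : A → V)
    (hφ : Function.Injective φ) (hadj : ∀ x y, P.Adj x y → G.Adj (φ x) (φ y))
    (R : Set (Sym2 V)) (hR : ∀ e ∈ R, ∀ a, φ a ∉ e) {T T' : Set (Sym2 A)}
    (h : IsSwitch P T T') :
    IsSwitch G (R ∪ Sym2.map φ '' T) (R ∪ Sym2.map φ '' T') := by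
  obtain ⟨u, v, u', v', h1, h2, h3, h4, h5, h6, hm, hm', ha, ha', rfl⟩ := h
  have hn : ∀ a b, s(φ a, φ b) ∉ R := fun a b h => hR _ h a (by simp)
  refine ⟨φ u, φ v, φ u', φ v', hφ.ne h1, hφ.ne h2, hφ.ne h3, hφ.ne h4, hφ.ne h5, hφ.ne h6,
    Or.inr ⟨_, hm, rfl⟩, Or.inr ⟨_, hm', rfl⟩, hadj _ _ ha, hadj _ _ ha', ?_⟩
  rw [Set.image_union, Set.image_sdiff (Sym2.map.injective hφ), Set.union_sdiff_distrib,
    Set.image_pair, Set.image_pair, Set.union_assoc]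
  congr 1
  rw [eq_comm, sdiff_eq_left, Set.disjoint_right]
  rintro e (rfl | rfl)
  · exact hn _ _
  · exact hn _ _

theorem Steps.lift {A V : Type*} {P : SimpleGraph A} {G : SimpleGraph V} (φ : A → V)
    (hφ : Function.Injective φ) (hadj : ∀ x y, P.Adj x y → G.Adj (φ x) (φ y))
    (R : Set (Sym2 V)) (hR : ∀ e ∈ R, ∀ a, φ a ∉ e) {n : ℕ} {T T' : Set (Sym2 A)}
    (h : Steps P n T T') :
    Steps G n (R ∪ Sym2.map φ '' T) (R ∪ Sym2.map φ '' T') := by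
  induction h with
  | refl M => exact .refl _
  | cons hs _ ih => exact .cons (hs.lift φ hφ hadj R hR) ih

/-! ### Local moves -/

/-- A decidable version of a switch, at the level of finsets. -/
theorem Steps.fcons {A : Type*} [DecidableEq A] {P : SimpleGraph A} {n : ℕ}
    {T : Finset (Sym2 A)} {T'' : Set (Sym2 A)} (u v u' v' : A)
    (h : (u ≠ v ∧ u ≠ u' ∧ u ≠ v' ∧ v ≠ u' ∧ v ≠ v' ∧ u' ≠ v') ∧
      s(u, v) ∈ T ∧ s(u', v') ∈ T ∧ P.Adj u' v ∧ P.Adj u v')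
    (h' : Steps P n (((T \ {s(u, v), s(u', v')}) ∪ {s(u', v), s(u, v')} : Finset (Sym2 A)) :
      Set (Sym2 A)) T'') : Steps P (n + 1) (T : Set (Sym2 A)) T'' := by
  refine .cons ?_ h'
  obtain ⟨⟨h1, h2, h3, h4, h5, h6⟩, hm, hm', ha, ha'⟩ := h
  exact ⟨u, v, u', v', h1, h2, h3, h4, h5, h6, by simpa using hm, by simpa using hm', ha, ha',
    by push_cast; rfl⟩

/-- The hexagonal prism. -/
def Prism : SimpleGraph (Fin 2 × ZMod 6) :=
  SimpleGraph.fromRel fun x y =>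
    (x.1 = y.1 ∧ y.2 = x.2 + 1) ∨ (x.2 = y.2 ∧ (y.1 : ℕ) = (x.1 : ℕ) + 1)

instance : DecidableRel Prism.Adj := fun x y => by
  unfold Prism
  rw [SimpleGraph.fromRel_adj]
  infer_instance

/-- The hexagon with the chord. -/
def HexC : SimpleGraph (ZMod 6) :=
  SimpleGraph.fromRel fun x y => y = x + 1 ∨ (x = 0 ∧ y = 3)

instance : DecidableRel HexC.Adj := fun x y => by
  unfold HexC
  rw [SimpleGraph.fromRel_adj]
  infer_instance

def hexT (c : Bool) : Finset (Sym2 (ZMod 6)) :=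
  (Finset.univ.filter fun j : ZMod 6 => (decide (j.val % 2 = 1)) = c).image fun j => s(j, j + 1)

def prismT (c : Bool) : Finset (Sym2 (Fin 2 × ZMod 6)) :=
  (Finset.univ.filter fun x : Fin 2 × ZMod 6 => (decide (x.2.val % 2 = 1)) = c).image
    fun x => s(x, (x.1, x.2 + 1))

theorem Steps.done {A : Type*} {P : SimpleGraph A} {S T : Finset (Sym2 A)} (h : S = T) :
    Steps P 0 (S : Set (Sym2 A)) (T : Set (Sym2 A)) := by subst h; exact .refl _

theorem hex_steps : Steps HexC 2 (hexT false : Set (Sym2 (ZMod 6))) (hexT true) := by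
  refine Steps.fcons 0 1 2 3 (by decide +kernel) ?_
  refine Steps.fcons 0 3 4 5 (by decide +kernel) ?_
  exact Steps.done (by decide +kernel)

theorem prism_steps (c : Bool) :
    Steps Prism 6 (prismT c : Set (Sym2 (Fin 2 × ZMod 6))) (prismT !c) := by
  cases c
  · refine Steps.fcons (0, 0) (0, 1) (1, 1) (1, 0) (by decide +kernel) ?_
    refine Steps.fcons (0, 2) (0, 3) (1, 3) (1, 2) (by decide +kernel) ?_
    refine Steps.fcons (0, 4) (0, 5) (1, 5) (1, 4) (by decide +kernel) ?_
    refine Steps.fcons (0, 1) (1, 1) (1, 2) (0, 2) (by decide +kernel) ?_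
    refine Steps.fcons (0, 3) (1, 3) (1, 4) (0, 4) (by decide +kernel) ?_
    refine Steps.fcons (0, 5) (1, 5) (1, 0) (0, 0) (by decide +kernel) ?_
    exact Steps.done (by decide +kernel)
  · refine Steps.fcons (0, 1) (0, 2) (1, 2) (1, 1) (by decide +kernel) ?_
    refine Steps.fcons (0, 3) (0, 4) (1, 4) (1, 3) (by decide +kernel) ?_
    refine Steps.fcons (0, 5) (0, 0) (1, 0) (1, 5) (by decide +kernel) ?_
    refine Steps.fcons (0, 0) (1, 0) (1, 1) (0, 1) (by decide +kernel) ?_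
    refine Steps.fcons (0, 2) (1, 2) (1, 3) (0, 3) (by decide +kernel) ?_
    refine Steps.fcons (0, 4) (1, 4) (1, 5) (0, 5) (by decide +kernel) ?_
    exact Steps.done (by decide +kernel)

/-! ### Ring matchings -/

/-- The matching made of hexagon edges whose parity on ring `i` is `b i`. -/
def RingM (k : ℕ) (b : ℕ → Bool) : Set (Sym2 (Fin k × ZMod 6)) :=
  {e | ∃ (i : Fin k) (j : ZMod 6), decide (j.val % 2 = 1) = b i ∧ e = s((i, j), (i, j + 1))}

theorem webM_one (k : ℕ) : WebM k 1 = RingM k fun i => decide (i % 2 = 1) := by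
  ext e
  simp only [WebM, RingM, Set.mem_ofPred_eq, decide_eq_decide]
  refine exists_congr fun i => exists_congr fun j => and_congr_left fun _ => ?_
  omega

theorem webM_two (k : ℕ) : WebM k 2 = RingM k fun i => decide (i % 2 = 0) := by
  ext e
  simp only [WebM, RingM, Set.mem_ofPred_eq, decide_eq_decide]
  refine exists_congr fun i => exists_congr fun j => and_congr_left fun _ => ?_
  omega

theorem ringM_congr {k : ℕ} {b c : ℕ → Bool} (h : ∀ i < k, b i = c i) :
    RingM k b = RingM k c := by
  ext e
  simp only [RingM, Set.mem_ofPred_eq]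
  refine exists_congr fun i => exists_congr fun j => ?_
  rw [h i i.2]

theorem zmod6_ne_succ (j : ZMod 6) : j ≠ j + 1 := by revert j; decide

theorem zmod6_parity (j : ZMod 6) :
    decide ((j + 1).val % 2 = 1) = !decide (j.val % 2 = 1) := by revert j; decide

theorem ringM_isPM (k : ℕ) (b : ℕ → Bool) : IsPM (Web k) (RingM k b) := by
  refine ⟨?_, ?_, ?_⟩
  · rintro e ⟨i, j, -, rfl⟩
    rw [SimpleGraph.mem_edgeSet, Web, SimpleGraph.fromRel_adj]
    refine ⟨fun h => zmod6_ne_succ j (congrArg Prod.snd h), Or.inl (Or.inl ⟨rfl, rfl⟩)⟩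
  · rintro e ⟨i, j, hj, rfl⟩ f ⟨i', j', hj', rfl⟩ hne w ⟨hw, hw'⟩
    apply hne
    have h1 := zmod6_parity j
    have h2 := zmod6_parity j'
    rcases Sym2.mem_iff.1 hw with rfl | rfl <;> rcases Sym2.mem_iff.1 hw' with h | h <;>
      rw [Prod.mk.injEq] at h <;> obtain ⟨rfl, h⟩ := h
    · rw [h]
    · rw [← hj', h, h2] at hj
      simp at hj
    · rw [← hj, ← h, h1] at hj'
      simp at hj'
    · rw [add_right_cancel h]
  · rintro ⟨i, j⟩
    by_cases h : decide (j.val % 2 = 1) = b i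
    · exact ⟨_, ⟨i, j, h, rfl⟩, by simp⟩
    · refine ⟨_, ⟨i, j - 1, ?_, rfl⟩, by simp⟩
      have := zmod6_parity (j - 1)
      rw [sub_add_cancel] at this
      rw [this] at h
      revert h
      cases b i <;> cases decide ((j - 1).val % 2 = 1) <;> simp

/-- The part of a ring matching on the rings outside `s`. -/
def RestM (k : ℕ) (b : ℕ → Bool) (s : ℕ → Prop) : Set (Sym2 (Fin k × ZMod 6)) :=
  {e | ∃ (i : Fin k) (j : ZMod 6), ¬ s i ∧ decide (j.val % 2 = 1) = b i ∧
    e = s((i, j), (i, j + 1))}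

theorem restM_congr {k : ℕ} {b c : ℕ → Bool} {s : ℕ → Prop} (h : ∀ i < k, ¬ s i → b i = c i) :
    RestM k b s = RestM k c s := by
  ext e
  simp only [RestM, Set.mem_ofPred_eq]
  refine exists_congr fun i => exists_congr fun j => and_congr_right fun hs => ?_
  rw [h i i.2 hs]

def phi1 (k : ℕ) (hk : 0 < k) (j : ZMod 6) : Fin k × ZMod 6 := (⟨0, hk⟩, j)

def phi2 (k l : ℕ) (hk : l + 1 < k) (x : Fin 2 × ZMod 6) : Fin k × ZMod 6 :=
  (⟨l + x.1, by have := x.1.2; omega⟩, x.2)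

theorem ringM_split1 (k : ℕ) (hk : 0 < k) (b : ℕ → Bool) :
    RingM k b = RestM k b (· = 0) ∪ Sym2.map (phi1 k hk) '' (hexT (b 0)) := by
  ext e
  constructor
  · rintro ⟨i, j, hj, rfl⟩
    by_cases hi : (i : ℕ) = 0
    · right
      refine ⟨s(j, j + 1), ?_, ?_⟩
      · rw [hi] at hj
        simp only [hexT, Finset.coe_image, Set.mem_image]
        exact ⟨j, by simpa using hj, rfl⟩
      · have : i = ⟨0, hk⟩ := Fin.ext hi
        subst this
        rfl
    · exact Or.inl ⟨i, j, hi, hj, rfl⟩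
  · rintro (⟨i, j, -, hj, rfl⟩ | ⟨e, he, rfl⟩)
    · exact ⟨i, j, hj, rfl⟩
    · simp only [hexT, Finset.coe_image, Set.mem_image] at he
      obtain ⟨j, hj, rfl⟩ := he
      exact ⟨⟨0, hk⟩, j, by simpa using hj, rfl⟩

theorem ringM_split2 (k l : ℕ) (hk : l + 1 < k) (b : ℕ → Bool) (c : Bool) (h1 : b l = c)
    (h2 : b (l + 1) = c) :
    RingM k b = RestM k b (fun i => i = l ∨ i = l + 1) ∪
      Sym2.map (phi2 k l hk) '' (prismT c) := by
  ext e
  constructor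
  · rintro ⟨i, j, hj, rfl⟩
    by_cases hi : (i : ℕ) = l ∨ (i : ℕ) = l + 1
    · right
      rcases hi with hi | hi
      · refine ⟨s((0, j), (0, j + 1)), ?_, ?_⟩
        · rw [hi, h1] at hj
          simp only [prismT, Finset.coe_image, Set.mem_image]
          exact ⟨(0, j), by simpa using hj, rfl⟩
        · have : i = ⟨l, by omega⟩ := Fin.ext hi
          rw [this]
          rfl
      · refine ⟨s((1, j), (1, j + 1)), ?_, ?_⟩
        · rw [hi, h2] at hj
          simp only [prismT, Finset.coe_image, Set.mem_image]
          exact ⟨(1, j), by simpa using hj, rfl⟩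
        · have : i = ⟨l + 1, by omega⟩ := Fin.ext hi
          subst this
          rfl
    · exact Or.inl ⟨i, j, hi, hj, rfl⟩
  · rintro (⟨i, j, -, hj, rfl⟩ | ⟨e, he, rfl⟩)
    · exact ⟨i, j, hj, rfl⟩
    · simp only [prismT, Finset.coe_image, Set.mem_image] at he
      obtain ⟨⟨t, j⟩, hj, rfl⟩ := he
      refine ⟨(phi2 k l hk (t, j)).1, j, ?_, rfl⟩
      have : b (l + t.val) = c := by
        fin_cases t
        · exact h1
        · exact h2
      simp only [phi2, this]
      simpa using hj

theorem ring_move1 (k : ℕ) (hk : 0 < k) (b c : ℕ → Bool) (hb : b 0 = false) (hc : c 0 = true)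
    (h : ∀ i < k, i ≠ 0 → b i = c i) : Steps (Web k) 2 (RingM k b) (RingM k c) := by
  rw [ringM_split1 k hk b, ringM_split1 k hk c, restM_congr h, hb, hc]
  refine hex_steps.lift _ ?_ ?_ _ ?_
  · intro x y h
    simpa [phi1] using h
  · intro x y h
    rw [HexC, SimpleGraph.fromRel_adj] at h
    rw [Web, SimpleGraph.fromRel_adj]
    simp only [phi1, ne_eq, Prod.mk.injEq, true_and]
    tauto
  · rintro e ⟨i, j, hi, -, rfl⟩ a ha
    apply hi
    rcases Sym2.mem_iff.1 ha with h | h <;> exact (congrArg (fun x => (x.1 : ℕ)) h).symm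

theorem ring_move2 (k l : ℕ) (hk : l + 1 < k) (b c : ℕ → Bool) (hb : b (l + 1) = b l)
    (hc : c l = !b l) (hc' : c (l + 1) = !b l)
    (h : ∀ i < k, ¬ (i = l ∨ i = l + 1) → b i = c i) :
    Steps (Web k) 6 (RingM k b) (RingM k c) := by
  rw [ringM_split2 k l hk b _ rfl hb, ringM_split2 k l hk c _ hc hc', restM_congr h]
  refine (prism_steps _).lift _ ?_ ?_ _ ?_
  · rintro ⟨x, i⟩ ⟨y, j⟩ h
    simp only [phi2, Prod.mk.injEq, Fin.mk.injEq] at h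
    ext
    · simp only; omega
    · exact h.2
  · rintro ⟨x, i⟩ ⟨y, j⟩ h
    rw [Prism, SimpleGraph.fromRel_adj] at h
    rw [Web, SimpleGraph.fromRel_adj]
    simp only [phi2, ne_eq, Prod.mk.injEq, Fin.mk.injEq, Fin.ext_iff] at h ⊢
    refine ⟨fun h' => h.1 ⟨by omega, h'.2⟩, ?_⟩
    rcases h.2 with (h | h) | (h | h)
    · exact Or.inl (Or.inl ⟨by omega, h.2⟩)
    · exact Or.inl (Or.inr (Or.inl ⟨h.1, by omega⟩))
    · exact Or.inr (Or.inl ⟨by omega, h.2⟩)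
    · exact Or.inr (Or.inr (Or.inl ⟨h.1, by omega⟩))
  · rintro e ⟨i, j, hi, -, rfl⟩ ⟨t, a⟩ ha
    apply hi
    have : l + t.val = i := by
      rcases Sym2.mem_iff.1 ha with h | h <;> exact congrArg (fun x => (x.1 : ℕ)) h
    have := t.2
    omega

/-! ### Global path -/

/-- Rings `< m` in the first pattern, rings `≥ m` in the second one. -/
def stB (m i : ℕ) : Bool := if m ≤ i then decide (i % 2 = 0) else decide (i % 2 = 1)

/-- As `stB`, with ring `l` in the second pattern. -/
def stD (m l i : ℕ) : Bool := if i = l ∨ m ≤ i then decide (i % 2 = 0) else decide (i % 2 = 1)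

theorem stage_inner (k m : ℕ) (hm : m < k) (l : ℕ) (hl : l ≤ m) :
    Steps (Web k) (2 + 6 * l) (RingM k (stB (m + 1))) (RingM k (stD (m + 1) l)) := by
  induction l with
  | zero =>
    refine ring_move1 k (by omega) _ _ (by simp [stB]) (by simp [stD]) ?_
    intro i _ hi
    simp [stB, stD, hi]
  | succ l ih =>
    refine (ih (by omega)).trans (n := 6) (ring_move2 k l (by omega) _ _ ?_ ?_ ?_ ?_)
    · have e1 : ¬ (l + 1 = l ∨ m + 1 ≤ l + 1) := by omega
      simp only [stD, e1, if_false, true_or, if_true, decide_eq_decide]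
      omega
    · have e1 : ¬ (l = l + 1 ∨ m + 1 ≤ l) := by omega
      simp only [stD, e1, if_false, true_or, if_true, ← decide_not, decide_eq_decide]
      omega
    · simp only [stD, true_or, if_true, ← decide_not, decide_eq_decide]
      omega
    · intro i _ hi
      have : (i = l ∨ m + 1 ≤ i) ↔ (i = l + 1 ∨ m + 1 ≤ i) := by omega
      simp only [stD, this]

theorem stage (k m : ℕ) (hm : m < k) :
    Steps (Web k) (2 + 6 * m) (RingM k (stB (m + 1))) (RingM k (stB m)) := by
  have h := stage_inner k m hm m le_rfl
  have : stD (m + 1) m = stB m := by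
    funext i
    have : (i = m ∨ m + 1 ≤ i) ↔ m ≤ i := by omega
    simp only [stD, stB, this]
  rwa [this] at h

theorem all_stages (k m : ℕ) (hm : m ≤ k) :
    Steps (Web k) (m * (3 * m - 1)) (RingM k (stB m)) (RingM k (stB 0)) := by
  induction m with
  | zero => simpa using Steps.refl _
  | succ m ih =>
    have := (stage k m hm).trans (ih (by omega))
    convert this using 1
    cases m with
    | zero => rfl
    | succ m =>
      have e1 : 3 * (m + 1 + 1) - 1 = 3 * m + 5 := by omega
      have e2 : 3 * (m + 1) - 1 = 3 * m + 2 := by omega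
      rw [e1, e2]
      ring

theorem full_path (k : ℕ) : Steps (Web k) (k * (3 * k - 1)) (WebM k 1) (WebM k 2) := by
  have h := all_stages k k le_rfl
  rw [webM_one, webM_two]
  have e1 : RingM k (stB k) = RingM k fun i => decide (i % 2 = 1) :=
    ringM_congr fun i hi => by simp [stB, Nat.not_le.2 hi]
  have e2 : RingM k (stB 0) = RingM k fun i => decide (i % 2 = 0) :=
    ringM_congr fun i hi => by simp [stB]
  rwa [e1, e2] at h

/-! ### The potential function -/

/-- Parity sign of an integer. -/
def sgz (z : ℤ) : ℤ := if z % 2 = 0 then 1 else -1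

theorem sgz_add (a b : ℤ) : sgz (a + b) = sgz a * sgz b := by
  unfold sgz
  rcases Int.emod_two_eq_zero_or_one a with ha | ha <;>
  rcases Int.emod_two_eq_zero_or_one b with hb | hb <;>
  simp [Int.add_emod, ha, hb]

theorem sgz_cases (a : ℤ) : sgz a = 1 ∨ sgz a = -1 := by
  unfold sgz
  split_ifs <;> simp

def sgj (j : ZMod 6) : ℤ := if j.val % 2 = 0 then 1 else -1

def epj (j : ZMod 6) : ℤ := if j = 1 ∨ j = 4 then 1 else 0

/-- Weight of the hexagon edge from `(i, j)` to `(i, j + 1)`. -/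
def wt (i : ℤ) (j : ZMod 6) : ℤ := sgz i * (sgj j * i + sgj j * epj j)

def fW {k : ℕ} (x y : Fin k × ZMod 6) : ℤ :=
  (if x.1 = y.1 ∧ y.2 = x.2 + 1 then wt (x.1 : ℕ) x.2 else 0) +
  (if y.1 = x.1 ∧ x.2 = y.2 + 1 then wt (y.1 : ℕ) y.2 else 0)

theorem fW_comm {k : ℕ} (x y : Fin k × ZMod 6) : fW x y = fW y x := by
  unfold fW; exact add_comm _ _

def eW {k : ℕ} : Sym2 (Fin k × ZMod 6) → ℤ := Sym2.lift ⟨fW, fW_comm⟩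

def dr (t : Fin 5) : ℤ := ![0, 0, 1, -1, 0] t

def dj (t : Fin 5) : ZMod 6 := ![1, -1, 0, 0, 3] t

def cP (t : Fin 5) (j : ZMod 6) : ℤ := ![sgj j, sgj (j - 1), 0, 0, 0] t

def cQ (t : Fin 5) (j : ZMod 6) : ℤ :=
  ![sgj j * epj j, sgj (j - 1) * epj (j - 1), 0, 0, 0] t

theorem zmod6_facts (j : ZMod 6) : j ≠ j + 1 + 1 ∧ j ≠ j + 1 ∧ j + 1 ≠ j := by
  revert j; decide

theorem adj_type {k : ℕ} {x y : Fin k × ZMod 6} (h : (Web k).Adj x y) :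
    ∃ t : Fin 5, ((y.1 : ℕ) : ℤ) = ((x.1 : ℕ) : ℤ) + dr t ∧ y.2 = x.2 + dj t ∧
      (t = 4 → ((x.1 : ℕ) : ℤ) = 0 ∧ (x.2 = 0 ∨ x.2 = 3)) ∧
      fW x y = sgz (x.1 : ℕ) * (cP t x.2 * (x.1 : ℕ) + cQ t x.2) := by
  obtain ⟨i, j⟩ := x
  obtain ⟨i', j'⟩ := y
  rw [Web, SimpleGraph.fromRel_adj] at h
  obtain ⟨-, h⟩ := h
  simp only at h
  rcases h with (⟨rfl, rfl⟩ | ⟨rfl, h⟩ | ⟨h1, h2, rfl, rfl⟩) |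
    (⟨rfl, rfl⟩ | ⟨rfl, h⟩ | ⟨h1, h2, rfl, rfl⟩)
  · refine ⟨0, by simp [dr], by simp [dj], by simp, ?_⟩
    simp [fW, cP, cQ, wt, (zmod6_facts j).1]
  · have hne : i ≠ i' := by rintro rfl; omega
    refine ⟨2, by simp [dr, h], by simp [dj], by simp, ?_⟩
    simp [fW, cP, cQ, hne, hne.symm]
  · refine ⟨4, by simp [dr, h1, h2], by simp [dj], by simp [h1], ?_⟩
    have e1 : ¬ ((3 : ZMod 6) = 0 + 1) := by decide
    have e2 : ¬ ((0 : ZMod 6) = 3 + 1) := by decide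
    simp only [fW, e1, e2, and_false, if_false]
    simp [cP, cQ]
  · refine ⟨1, by simp [dr], by simp [dj], by simp, ?_⟩
    simp [fW, cP, cQ, wt, (zmod6_facts j').1]
  · have hne : i ≠ i' := by rintro rfl; omega
    refine ⟨3, by simp [dr, h], by simp [dj], by simp, ?_⟩
    simp [fW, cP, cQ, hne, hne.symm]
  · have e3 : (0 : ZMod 6) = 3 + 3 := by decide
    refine ⟨4, by simp [dr, h1, h2], by simpa [dj] using e3, by simp [h2], ?_⟩
    have e1 : ¬ ((3 : ZMod 6) = 0 + 1) := by decide
    have e2 : ¬ ((0 : ZMod 6) = 3 + 1) := by decide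
    simp only [fW, e1, e2, and_false, if_false]
    simp [cP, cQ]

set_option maxRecDepth 10000 in
set_option synthInstance.maxHeartbeats 400000 in
set_option synthInstance.maxSize 2000 in
theorem cycle_check : ∀ t1 t2 t3 t4 : Fin 5,
    dr t1 + dr t2 + dr t3 + dr t4 = 0 → dj t1 + dj t2 + dj t3 + dj t4 = 0 →
    ¬ (dr t1 + dr t2 = 0 ∧ dj t1 + dj t2 = 0) → ¬ (dr t2 + dr t3 = 0 ∧ dj t2 + dj t3 = 0) →
    (t1 = 4 → t3 = 4 → dr t1 + dr t2 = 0) →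
    (t2 = 4 → t4 = 4 → dr t2 + dr t3 = 0) →
    ∀ j : ZMod 6, (t1 = 4 → j = 0 ∨ j = 3) → (t2 = 4 → j + dj t1 = 0 ∨ j + dj t1 = 3) →
    (t3 = 4 → j + dj t1 + dj t2 = 0 ∨ j + dj t1 + dj t2 = 3) →
    (t4 = 4 → j + dj t1 + dj t2 + dj t3 = 0 ∨ j + dj t1 + dj t2 + dj t3 = 3) →
    ((cP t1 j - sgz (dr t1) * cP t2 (j + dj t1) +
      sgz (dr t1 + dr t2) * cP t3 (j + dj t1 + dj t2) -
      sgz (dr t1 + dr t2 + dr t3) * cP t4 (j + dj t1 + dj t2 + dj t3) = 0) ∨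
      t1 = 4 ∨ (t2 = 4 ∧ dr t1 = 0) ∨ (t3 = 4 ∧ dr t1 + dr t2 = 0) ∨
      (t4 = 4 ∧ dr t1 + dr t2 + dr t3 = 0)) ∧
    |cQ t1 j - sgz (dr t1) * (cP t2 (j + dj t1) * dr t1 + cQ t2 (j + dj t1)) +
      sgz (dr t1 + dr t2) * (cP t3 (j + dj t1 + dj t2) * (dr t1 + dr t2) +
        cQ t3 (j + dj t1 + dj t2)) -
      sgz (dr t1 + dr t2 + dr t3) * (cP t4 (j + dj t1 + dj t2 + dj t3) *
        (dr t1 + dr t2 + dr t3) + cQ t4 (j + dj t1 + dj t2 + dj t3))| ≤ 1 := by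
  decide +kernel

theorem cycle_bound {k : ℕ} {u v u' v' : Fin k × ZMod 6} (h1 : (Web k).Adj u v)
    (h2 : (Web k).Adj v u') (h3 : (Web k).Adj u' v') (h4 : (Web k).Adj v' u)
    (hu : u ≠ u') (hv : v ≠ v') :
    |fW u v - fW v u' + fW u' v' - fW v' u| ≤ 1 := by
  obtain ⟨t1, r1, j1, c1, w1⟩ := adj_type h1
  obtain ⟨t2, r2, j2, c2, w2⟩ := adj_type h2
  obtain ⟨t3, r3, j3, c3, w3⟩ := adj_type h3
  obtain ⟨t4, r4, j4, c4, w4⟩ := adj_type h4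
  have ne_of : ∀ x y : Fin k × ZMod 6, x ≠ y →
      ∀ r : ℤ, ∀ s : ZMod 6, ((y.1 : ℕ) : ℤ) = ((x.1 : ℕ) : ℤ) + r → y.2 = x.2 + s →
      ¬ (r = 0 ∧ s = 0) := by
    rintro x y hxy r s hr hs ⟨rfl, rfl⟩
    apply hxy
    refine Prod.ext (Fin.ext ?_) ?_
    · omega
    · simpa using hs.symm
  have n1 := ne_of u u' hu (dr t1 + dr t2) (dj t1 + dj t2) (by omega) (by rw [j2, j1, add_assoc])
  have n2 := ne_of v v' hv (dr t2 + dr t3) (dj t2 + dj t3) (by omega) (by rw [j3, j2, add_assoc])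
  have hj : dj t1 + dj t2 + dj t3 + dj t4 = 0 := by
    have : u.2 + (dj t1 + dj t2 + dj t3 + dj t4) = u.2 + 0 := by
      conv_rhs => rw [j4, j3, j2, j1]
      ring
    exact add_left_cancel this
  obtain ⟨hα, hβ⟩ := cycle_check t1 t2 t3 t4 (by omega) hj n1 n2
    (fun a b => by have := (c1 a).1; have := (c3 b).1; omega)
    (fun a b => by have := (c2 a).1; have := (c4 b).1; omega)
    u.2 (fun a => (c1 a).2) (fun a => j1 ▸ (c2 a).2)
    (fun a => by have := (c3 a).2; rwa [j2, j1] at this)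
    (fun a => by have := (c4 a).2; rwa [j3, j2, j1] at this)
  rw [w1, w2, w3, w4, j3, j2, j1, r3, r2, r1]
  generalize ((u.1 : ℕ) : ℤ) = a at *
  have hα' : (cP t1 u.2 - sgz (dr t1) * cP t2 (u.2 + dj t1) +
      sgz (dr t1 + dr t2) * cP t3 (u.2 + dj t1 + dj t2) -
      sgz (dr t1 + dr t2 + dr t3) * cP t4 (u.2 + dj t1 + dj t2 + dj t3)) * a = 0 := by
    rcases hα with h | h | ⟨h, h'⟩ | ⟨h, h'⟩ | ⟨h, h'⟩
    · rw [h, zero_mul]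
    · rw [(c1 h).1, mul_zero]
    · have := (c2 h).1
      rw [show a = 0 by omega, mul_zero]
    · have := (c3 h).1
      rw [show a = 0 by omega, mul_zero]
    · have := (c4 h).1
      rw [show a = 0 by omega, mul_zero]
  have e2 : a + dr t1 + dr t2 = a + (dr t1 + dr t2) := by ring
  have e3 : a + (dr t1 + dr t2) + dr t3 = a + (dr t1 + dr t2 + dr t3) := by ring
  rw [e2, e3, sgz_add a (dr t1), sgz_add a (dr t1 + dr t2), sgz_add a (dr t1 + dr t2 + dr t3)]
  refine le_trans (le_of_eq ?_) hβ
  have habs : |sgz a| = 1 := by rcases sgz_cases a with h | h <;> simp [h]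
  rw [← one_mul |cQ t1 u.2 - _ + _ - _|, ← habs, ← abs_mul]
  congr 1
  linear_combination sgz a * hα'

open Classical in
/-- The total weight of a set of edges. -/
noncomputable def pot {k : ℕ} (M : Set (Sym2 (Fin k × ZMod 6))) : ℤ :=
  ∑ e, if e ∈ M then eW e else 0

theorem pot_swap {k : ℕ} {M M' : Set (Sym2 (Fin k × ZMod 6))} {e₁ e₂ f₁ f₂ : Sym2 (Fin k × ZMod 6)}
    (h1 : e₁ ∈ M) (h2 : e₂ ∈ M) (h3 : f₁ ∉ M) (h4 : f₂ ∉ M) (h5 : e₁ ≠ e₂) (h6 : f₁ ≠ f₂)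
    (h : ∀ e, e ∈ M' ↔ (e = f₁ ∨ e = f₂) ∨ (e ∈ M ∧ ¬ (e = e₁ ∨ e = e₂))) :
    pot M - pot M' = eW e₁ + eW e₂ - eW f₁ - eW f₂ := by
  classical
  have hpt : ∀ e, ((if e ∈ M then eW e else 0) - (if e ∈ M' then eW e else 0)) =
      (if e = e₁ then eW e else 0) + (if e = e₂ then eW e else 0) -
      (if e = f₁ then eW e else 0) - (if e = f₂ then eW e else 0) := by
    intro e
    have := h e
    by_cases a1 : e = e₁
    · subst a1
      have : e ≠ f₁ := fun h => h3 (h ▸ h1)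
      have : e ≠ f₂ := fun h => h4 (h ▸ h1)
      simp_all
    by_cases a2 : e = e₂
    · subst a2
      have : e ≠ f₁ := fun h => h3 (h ▸ h2)
      have : e ≠ f₂ := fun h => h4 (h ▸ h2)
      simp_all
    by_cases a3 : e = f₁
    · subst a3
      simp_all
    by_cases a4 : e = f₂
    · subst a4
      simp_all
    simp_all
  unfold pot
  rw [← Finset.sum_sub_distrib]
  refine (Finset.sum_congr rfl fun e _ => hpt e).trans ?_
  simp only [Finset.sum_sub_distrib, Finset.sum_add_distrib, Finset.sum_ite_eq',
    Finset.mem_univ, if_true]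

theorem pot_switch {k : ℕ} {M M' : Set (Sym2 (Fin k × ZMod 6))} (hM : IsPM (Web k) M)
    (hs : IsSwitch (Web k) M M') : |pot M - pot M'| ≤ 1 := by
  classical
  obtain ⟨u, v, u', v', h1, h2, h3, h4, h5, h6, hm, hm', ha, ha', rfl⟩ := hs
  obtain ⟨hsub, hdis, -⟩ := hM
  have hb := cycle_bound (hsub hm : (Web k).Adj u v) ha.symm (hsub hm' : (Web k).Adj u' v')
    ha'.symm h2 h5
  have nf1 : s(u', v) ∉ M := fun h => by
    refine hdis _ h _ hm ?_ v ⟨by simp, by simp⟩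
    simp [Sym2.eq_iff]
    tauto
  have nf2 : s(u, v') ∉ M := fun h => by
    refine hdis _ h _ hm ?_ u ⟨by simp, by simp⟩
    simp [Sym2.eq_iff]
    tauto
  have ne1 : s(u, v) ≠ s(u', v') := by
    simp [Sym2.eq_iff]
    tauto
  have ne2 : s(u', v) ≠ s(u, v') := by
    simp [Sym2.eq_iff]
    tauto
  have key : pot M - pot ((M \ {s(u, v), s(u', v')}) ∪ {s(u', v), s(u, v')}) =
      eW s(u, v) + eW s(u', v') - eW s(u', v) - eW s(u, v') := by
    refine pot_swap hm hm' nf1 nf2 ne1 ne2 fun e => ?_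
    simp only [Set.mem_union, Set.mem_sdiff, Set.mem_insert_iff, Set.mem_singleton_iff]
    tauto
  rw [key]
  have e : eW s(u, v) + eW s(u', v') - eW s(u', v) - eW s(u, v') =
      fW u v - fW v u' + fW u' v' - fW v' u := by
    rw [fW_comm v u', fW_comm v' u]
    simp only [eW, Sym2.lift_mk]
    ring
  rwa [e]

theorem pot_walk {k : ℕ} {A B : {M : Set (Sym2 (Fin k × ZMod 6)) // IsPM (Web k) M}}
    (p : (TransGraph (Web k)).Walk A B) : |pot A.1 - pot B.1| ≤ p.length := by
  induction p with
  | nil => simp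
  | @cons A B C h p ih =>
    rw [TransGraph, SimpleGraph.fromRel_adj] at h
    have h1 : |pot A.1 - pot B.1| ≤ 1 := by
      rcases h.2 with h | h
      · exact pot_switch A.2 h
      · rw [abs_sub_comm]
        exact pot_switch B.2 h
    rw [SimpleGraph.Walk.length_cons]
    push_cast
    linarith [abs_sub_le (pot A.1) (pot B.1) (pot C.1)]

theorem sum_zmod6 (f : ZMod 6 → ℤ) : ∑ j, f j = f 0 + f 1 + f 2 + f 3 + f 4 + f 5 :=
  Fin.sum_univ_six f

theorem pot_webM (k p : ℕ) : pot (WebM k p) =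
    ∑ i : Fin k, ∑ j : ZMod 6,
      if ((i : ℕ) + j.val) % 2 = (p - 1) % 2 then wt (i : ℕ) j else 0 := by
  classical
  have himg : (Finset.univ.filter fun e => e ∈ WebM k p) =
      (Finset.univ.filter fun x : Fin k × ZMod 6 =>
        ((x.1 : ℕ) + x.2.val) % 2 = (p - 1) % 2).image fun x => s(x, (x.1, x.2 + 1)) := by
    ext e
    simp only [Finset.mem_filter, Finset.mem_univ, true_and, Finset.mem_image]
    constructor
    · rintro ⟨i, j, h, rfl⟩
      exact ⟨(i, j), h, rfl⟩
    · rintro ⟨⟨i, j⟩, h, rfl⟩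
      exact ⟨i, j, h, rfl⟩
  have hinj : Function.Injective fun x : Fin k × ZMod 6 => s(x, (x.1, x.2 + 1)) := by
    rintro ⟨i, j⟩ ⟨i', j'⟩ h
    simp only [Sym2.eq_iff, Prod.mk.injEq] at h
    rcases h with h | ⟨⟨-, h⟩, -, h'⟩
    · exact Prod.ext h.1.1 h.1.2
    · exact absurd (h' ▸ h) (zmod6_facts j).1
  unfold pot
  rw [← Finset.sum_filter, himg, Finset.sum_image fun x _ y _ h => hinj h, Finset.sum_filter,
    Fintype.sum_prod_type]
  refine Finset.sum_congr rfl fun i _ => Finset.sum_congr rfl fun j _ => ?_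
  simp [eW, fW, (zmod6_facts j).1]

theorem pot_ring (i : ℕ) (p : ℕ) (hp : p = 1 ∨ p = 2) :
    (∑ j : ZMod 6, if (i + j.val) % 2 = (p - 1) % 2 then wt (i : ℕ) j else 0) =
      (if p = 1 then 1 else -1) * (3 * (i : ℤ) + 1) := by
  have v0 : (0 : ZMod 6).val = 0 := rfl
  have v1 : (1 : ZMod 6).val = 1 := rfl
  have v2 : (2 : ZMod 6).val = 2 := rfl
  have v3 : (3 : ZMod 6).val = 3 := rfl
  have v4 : (4 : ZMod 6).val = 4 := rfl
  have v5 : (5 : ZMod 6).val = 5 := rfl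
  have q0 : epj 0 = 0 := by decide
  have q1 : epj 1 = 1 := by decide
  have q2 : epj 2 = 0 := by decide
  have q3 : epj 3 = 0 := by decide
  have q4 : epj 4 = 1 := by decide
  have q5 : epj 5 = 0 := by decide
  rw [sum_zmod6]
  simp only [wt, sgj, q0, q1, q2, q3, q4, q5, v0, v1, v2, v3, v4, v5, sgz]
  rcases Nat.mod_two_eq_zero_or_one i with hi | hi
  · have hz : (i : ℤ) % 2 = 0 := by omega
    rcases hp with rfl | rfl <;> simp [Nat.add_mod, hi, hz] <;> ring
  · have hz : (i : ℤ) % 2 = 1 := by omega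
    rcases hp with rfl | rfl <;> simp [Nat.add_mod, hi, hz] <;> ring

theorem sum_ring (k : ℕ) : 2 * ∑ i : Fin k, (3 * ((i : ℕ) : ℤ) + 1) = k * (3 * k - 1) := by
  induction k with
  | zero => simp
  | succ k ih =>
    rw [Fin.sum_univ_castSucc, mul_add]
    simp only [Fin.val_castSucc, Fin.val_last]
    rw [ih]
    push_cast
    ring

theorem pot_diff (k : ℕ) : pot (WebM k 1) - pot (WebM k 2) = k * (3 * k - 1) := by
  rw [pot_webM, pot_webM, Finset.sum_congr rfl fun i _ => pot_ring (i : Fin k) 1 (Or.inl rfl),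
    Finset.sum_congr rfl fun i _ => pot_ring (i : Fin k) 2 (Or.inr rfl), ← sum_ring,
    ← Finset.mul_sum, ← Finset.mul_sum]
  simp only [if_true, OfNat.ofNat_ne_one, if_false]
  ring

/-- For every `k ≥ 1`, the distance between the perfect
matchings `M₁` and `M₂` in the transition graph of the spider's web `W_k` is
exactly `k * (3 * k - 1)`. -/
theorem web_dist_M1_M2 (k : ℕ) (hk : 1 ≤ k) :
    ∃ (h₁ : IsPM (Web k) (WebM k 1)) (h₂ : IsPM (Web k) (WebM k 2)),
      (TransGraph (Web k)).Reachable ⟨WebM k 1, h₁⟩ ⟨WebM k 2, h₂⟩ ∧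
      (TransGraph (Web k)).dist ⟨WebM k 1, h₁⟩ ⟨WebM k 2, h₂⟩ = k * (3 * k - 1) := by
  have h₁ : IsPM (Web k) (WebM k 1) := webM_one k ▸ ringM_isPM k _
  obtain ⟨h₂, p, hp⟩ := (full_path k).walk h₁
  refine ⟨h₁, h₂, p.reachable, le_antisymm ((SimpleGraph.dist_le p).trans hp) ?_⟩
  obtain ⟨q, hq⟩ := p.reachable.exists_walk_length_eq_dist
  rw [← hq]
  have h := le_trans (le_abs_self _) (pot_walk q)
  simp only [pot_diff] at h
  have e : ((3 * k - 1 : ℕ) : ℤ) = 3 * k - 1 := by omega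
  rw [← e] at h
  exact_mod_cast h
end

section
/- Let G be a finite simple graph whose vertex set partitions into two disjoint cliques X and Y with |X| = n and |Y| = m. For s ∈ ℕ, let Mₛ be the number of matchings of G of size exactly s all of whose edges have one endpoint in X and one endpoint in Y. Then the number of perfect matchings of G equals Σ_{s=0}^{min(n,m)} Mₛ · p(n − s) · p(m − s), where p(t) denotes the number of perfect matchings of the complete graph K_t (so p(t) = 0 for t odd and p(2a) = (2a)!/(2^a · a!)). -/
/-- A matching of `G`, viewed as a set of edges: a set of pairwise disjoint
edges of `G`. -/
def IsMatching {V : Type*} (G : SimpleGraph V) (M : Set (Sym2 V)) : Prop :=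
  M ⊆ G.edgeSet ∧ ∀ e ∈ M, ∀ f ∈ M, e ≠ f → ∀ v : V, ¬(v ∈ e ∧ v ∈ f)

/-- `p(t)`: the number of perfect matchings of the complete graph `K_t`
(so `p(t) = 0` for `t` odd and `p(2a) = (2a)! / (2^a · a!)`). -/
noncomputable def numPMComplete (t : ℕ) : ℕ :=
  Nat.card {M : Set (Sym2 (Fin t)) // IsPM (⊤ : SimpleGraph (Fin t)) M}

/-- `M` is a perfect matching of the complete graph on the subset `A`. -/
def PMOn {V : Type*} (A : Set V) (M : Set (Sym2 V)) : Prop :=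
  (∀ e ∈ M, ¬ e.IsDiag) ∧ (∀ e ∈ M, ∀ v ∈ e, v ∈ A) ∧
    (∀ e ∈ M, ∀ f ∈ M, e ≠ f → ∀ v : V, ¬(v ∈ e ∧ v ∈ f)) ∧
    (∀ v ∈ A, ∃ e ∈ M, v ∈ e)

theorem PMOn_image {V W : Type*} (f : W → V) (hf : Function.Injective f) (M : Set (Sym2 W)) :
    PMOn (Set.range f) (Sym2.map f '' M) ↔ IsPM (⊤ : SimpleGraph W) M := by
  have inj := Sym2.map.injective hf
  constructor
  · rintro ⟨h1, h2, h3, h4⟩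
    refine ⟨?_, ?_, ?_⟩
    · intro e he
      have := h1 _ ⟨e, he, rfl⟩
      induction e with | _ a b =>
      simp only [Sym2.map_mk, Sym2.mk_isDiag_iff] at this
      simp only [SimpleGraph.mem_edgeSet, SimpleGraph.top_adj]
      exact fun h => this (congrArg f h)
    · intro e he e' he' hne v hv
      exact h3 _ ⟨e, he, rfl⟩ _ ⟨e', he', rfl⟩ (fun h => hne (inj h)) (f v)
        ⟨Sym2.mem_map.2 ⟨v, hv.1, rfl⟩, Sym2.mem_map.2 ⟨v, hv.2, rfl⟩⟩
    · intro v
      obtain ⟨_, ⟨e, he, rfl⟩, hv⟩ := h4 (f v) ⟨v, rfl⟩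
      obtain ⟨w, hw, hwv⟩ := Sym2.mem_map.1 hv
      exact ⟨e, he, hf hwv ▸ hw⟩
  · rintro ⟨h1, h3, h4⟩
    refine ⟨?_, ?_, ?_, ?_⟩
    · rintro _ ⟨e, he, rfl⟩
      have := h1 he
      induction e with | _ a b =>
      simp only [SimpleGraph.mem_edgeSet, SimpleGraph.top_adj] at this
      simp only [Sym2.map_mk, Sym2.mk_isDiag_iff]
      exact fun h => this (hf h)
    · rintro _ ⟨e, he, rfl⟩ v hv
      obtain ⟨w, hw, rfl⟩ := Sym2.mem_map.1 hv
      exact ⟨w, rfl⟩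
    · rintro _ ⟨e, he, rfl⟩ _ ⟨e', he', rfl⟩ hne v ⟨hv, hv'⟩
      obtain ⟨w, hw, rfl⟩ := Sym2.mem_map.1 hv
      obtain ⟨w', hw', hww⟩ := Sym2.mem_map.1 hv'
      obtain rfl := hf hww
      exact h3 e he e' he' (fun h => hne (by rw [h])) _ ⟨hw, hw'⟩
    · rintro _ ⟨w, rfl⟩
      obtain ⟨e, he, hw⟩ := h4 w
      exact ⟨_, ⟨e, he, rfl⟩, Sym2.mem_map.2 ⟨w, hw, rfl⟩⟩

theorem card_PMOn {V : Type*} [Finite V] (A : Set V) :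
    Nat.card {M : Set (Sym2 V) // PMOn A M} = numPMComplete A.ncard := by
  classical
  have e : Fin A.ncard ≃ A := (Finite.equivFinOfCardEq (Nat.card_coe_set_eq A)).symm
  let f : Fin A.ncard → V := fun i => (e i : V)
  have hf : Function.Injective f := fun a b h => e.injective (Subtype.ext h)
  have hr : Set.range f = A := by
    ext v
    constructor
    · rintro ⟨i, rfl⟩
      exact (e i).2
    · intro hv
      exact ⟨e.symm ⟨v, hv⟩, by simp [f]⟩
  symm
  unfold numPMComplete
  refine Nat.card_eq_of_bijective
    (fun M => ⟨Sym2.map f '' M.1, by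
      have := (PMOn_image f hf M.1).2 M.2
      rwa [hr] at this⟩) ⟨?_, ?_⟩
  · intro M N h
    exact Subtype.ext (Set.image_injective.2 (Sym2.map.injective hf) (congrArg Subtype.val h))
  · rintro ⟨M, hM⟩
    have hsub : M ⊆ Set.range (Sym2.map f) := by
      intro e he
      have := hM.2.1 e he
      induction e with | _ a b =>
      obtain ⟨i, hi⟩ : a ∈ Set.range f := hr.symm ▸ (this a (by simp))
      obtain ⟨j, hj⟩ : b ∈ Set.range f := hr.symm ▸ (this b (by simp))
      exact ⟨s(i, j), by simp [hi, hj]⟩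
    have him := Set.image_preimage_eq_of_subset hsub
    refine ⟨⟨Sym2.map f ⁻¹' M, ?_⟩, Subtype.ext him⟩
    rw [← PMOn_image f hf, him, hr]
    exact hM

/-- The vertices covered by a set of edges. -/
def covered {V : Type*} (C : Set (Sym2 V)) : Set V := {v | ∃ e ∈ C, v ∈ e}

/-- All edges of `C` join `X` to `Y`. -/
def CrossAll {V : Type*} (X Y : Set V) (C : Set (Sym2 V)) : Prop :=
  ∀ e ∈ C, ∃ u ∈ X, ∃ v ∈ Y, e = s(u, v)

theorem ncard_inter_covered {V : Type*} [Finite V] (X Y : Set V) (hXY : Disjoint X Y)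
    (C : Set (Sym2 V)) (hd : ∀ e ∈ C, ∀ f ∈ C, e ≠ f → ∀ v : V, ¬(v ∈ e ∧ v ∈ f))
    (hC : CrossAll X Y C) : C.ncard = (X ∩ covered C).ncard := by
  choose f hf g hg hfg using hC
  have hmem : ∀ e he, f e he ∈ e := by
    intro e he
    have h := hfg e he
    generalize f e he = a at h ⊢
    generalize g e he = b at h
    rw [h]
    simp
  refine Set.ncard_congr f ?_ ?_ ?_
  · intro e he
    exact ⟨hf e he, e, he, hmem e he⟩
  · intro e e' he he' h
    by_contra hne
    exact hd e he e' he' hne (f e he) ⟨hmem e he, h ▸ hmem e' he'⟩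
  · rintro v ⟨hv, e, he, hve⟩
    refine ⟨e, he, ?_⟩
    have h2 : v ∈ s(f e he, g e he) := (hfg e he) ▸ hve
    rcases Sym2.mem_iff.1 h2 with h | h
    · exact h.symm
    · exact absurd (h ▸ hg e he) (Set.disjoint_left.1 hXY hv)

theorem ncard_diff_covered {V : Type*} [Finite V] (X Y : Set V) (hXY : Disjoint X Y)
    (C : Set (Sym2 V)) (hd : ∀ e ∈ C, ∀ f ∈ C, e ≠ f → ∀ v : V, ¬(v ∈ e ∧ v ∈ f))
    (hC : CrossAll X Y C) :
    C.ncard ≤ X.ncard ∧ (X \ covered C).ncard = X.ncard - C.ncard := by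
  have h := ncard_inter_covered X Y hXY C hd hC
  have h2 := Set.ncard_inter_add_ncard_sdiff_eq_ncard X (covered C)
  omega

/-- The edges joining `X` to its complement. -/
def crossEdges {V : Type*} (X : Set V) : Set (Sym2 V) := {e | ∃ u ∈ X, ∃ v ∈ Xᶜ, e = s(u, v)}

/-- The edges inside `A`. -/
def inEdges {V : Type*} (A : Set V) : Set (Sym2 V) := {e | ∀ v ∈ e, v ∈ A}

theorem edge_cases_s19 {V : Type*} (X : Set V) (e : Sym2 V) :
    e ∈ crossEdges X ∨ e ∈ inEdges X ∨ e ∈ inEdges Xᶜ := by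
  induction e with | _ a b =>
  by_cases ha : a ∈ X <;> by_cases hb : b ∈ X
  · right; left; intro v hv; rcases Sym2.mem_iff.1 hv with rfl | rfl <;> assumption
  · exact Or.inl ⟨a, ha, b, hb, rfl⟩
  · exact Or.inl ⟨b, hb, a, ha, Sym2.eq_swap⟩
  · right; right; intro v hv; rcases Sym2.mem_iff.1 hv with rfl | rfl <;> assumption

theorem not_cross_of_in {V : Type*} (X : Set V) (e : Sym2 V) (h : e ∈ crossEdges X) :
    e ∉ inEdges X ∧ e ∉ inEdges Xᶜ := by
  obtain ⟨u, hu, v, hv, rfl⟩ := h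
  exact ⟨fun h => hv (h v (by simp)), fun h => h u (by simp) hu⟩

theorem not_in_both {V : Type*} (X : Set V) (e : Sym2 V) (h : e ∈ inEdges X) :
    e ∉ inEdges Xᶜ := by
  induction e with | _ a b =>
  exact fun h' => h' a (by simp) (h a (by simp))

/-- Restricting a perfect matching to a union of classes. -/
theorem PMOn_restrict {V : Type*} (G : SimpleGraph V) (X A : Set V) (hA : A = X ∨ A = Xᶜ)
    (M : Set (Sym2 V)) (hM : IsPM G M) :
    PMOn (A \ covered (M ∩ crossEdges X)) (M ∩ inEdges A) := by
  obtain ⟨h1, h2, h3⟩ := hM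
  refine ⟨?_, ?_, ?_, ?_⟩
  · intro e he
    exact G.not_isDiag_of_mem_edgeSet (h1 he.1)
  · rintro e ⟨he, heA⟩ v hv
    refine ⟨heA v hv, ?_⟩
    rintro ⟨f, ⟨hf, hfc⟩, hvf⟩
    refine h2 e he f hf ?_ v ⟨hv, hvf⟩
    rintro rfl
    have := not_cross_of_in X e hfc
    rcases hA with rfl | rfl
    · exact this.1 heA
    · exact this.2 heA
  · exact fun e he f hf => h2 e he.1 f hf.1
  · rintro v ⟨hvA, hv⟩
    obtain ⟨e, he, hve⟩ := h3 v
    refine ⟨e, ⟨he, ?_⟩, hve⟩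
    rcases edge_cases_s19 X e with h | h | h
    · exact absurd ⟨e, ⟨he, h⟩, hve⟩ hv
    · rcases hA with rfl | rfl
      · exact h
      · exact absurd (h v hve) hvA
    · rcases hA with rfl | rfl
      · exact absurd hvA (h v hve)
      · exact h

theorem edge_of_clique {V : Type*} (G : SimpleGraph V) (A : Set V)
    (hA : ∀ u ∈ A, ∀ v ∈ A, u ≠ v → G.Adj u v) (e : Sym2 V) (hd : ¬ e.IsDiag)
    (he : ∀ v ∈ e, v ∈ A) : e ∈ G.edgeSet := by
  induction e with | _ a b =>
  exact hA a (he a (by simp)) b (he b (by simp)) (by simpa using hd)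

theorem IsPM_union {V : Type*} (G : SimpleGraph V) (X : Set V)
    (hX : ∀ u ∈ X, ∀ v ∈ X, u ≠ v → G.Adj u v)
    (hXc : ∀ u ∈ Xᶜ, ∀ v ∈ Xᶜ, u ≠ v → G.Adj u v)
    (C P Q : Set (Sym2 V)) (hC : IsMatching G C)
    (hP : PMOn (X \ covered C) P) (hQ : PMOn (Xᶜ \ covered C) Q) :
    IsPM G (C ∪ P ∪ Q) := by
  obtain ⟨c1, c2⟩ := hC
  obtain ⟨p1, p2, p3, p4⟩ := hP
  obtain ⟨q1, q2, q3, q4⟩ := hQ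
  have cp : ∀ e ∈ C, ∀ f ∈ P, ∀ v, v ∈ e → v ∈ f → False :=
    fun e he f hf v hv hv' => (p2 f hf v hv').2 ⟨e, he, hv⟩
  have cq : ∀ e ∈ C, ∀ f ∈ Q, ∀ v, v ∈ e → v ∈ f → False :=
    fun e he f hf v hv hv' => (q2 f hf v hv').2 ⟨e, he, hv⟩
  have pq : ∀ e ∈ P, ∀ f ∈ Q, ∀ v, v ∈ e → v ∈ f → False :=
    fun e he f hf v hv hv' => (q2 f hf v hv').1 (p2 e he v hv).1
  refine ⟨?_, ?_, ?_⟩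
  · rintro e ((he | he) | he)
    · exact c1 he
    · exact edge_of_clique G X hX e (p1 e he) (fun v hv => (p2 e he v hv).1)
    · exact edge_of_clique G Xᶜ hXc e (q1 e he) (fun v hv => (q2 e he v hv).1)
  · rintro e ((he | he) | he) f ((hf | hf) | hf) hne v ⟨hv, hv'⟩
    · exact c2 e he f hf hne v ⟨hv, hv'⟩
    · exact cp e he f hf v hv hv'
    · exact cq e he f hf v hv hv'
    · exact cp f hf e he v hv' hv
    · exact p3 e he f hf hne v ⟨hv, hv'⟩
    · exact pq e he f hf v hv hv'
    · exact cq f hf e he v hv' hv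
    · exact pq f hf e he v hv' hv
    · exact q3 e he f hf hne v ⟨hv, hv'⟩
  · intro v
    by_cases hv : v ∈ covered C
    · obtain ⟨e, he, h⟩ := hv
      exact ⟨e, Or.inl (Or.inl he), h⟩
    · by_cases hvX : v ∈ X
      · obtain ⟨e, he, h⟩ := p4 v ⟨hvX, hv⟩
        exact ⟨e, Or.inl (Or.inr he), h⟩
      · obtain ⟨e, he, h⟩ := q4 v ⟨hvX, hv⟩
        exact ⟨e, Or.inr he, h⟩

theorem union_inter {V : Type*} (X : Set V) (C P Q : Set (Sym2 V)) (hC : C ⊆ crossEdges X)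
    (hP : P ⊆ inEdges X) (hQ : Q ⊆ inEdges Xᶜ) :
    (C ∪ P ∪ Q) ∩ crossEdges X = C ∧ (C ∪ P ∪ Q) ∩ inEdges X = P ∧
      (C ∪ P ∪ Q) ∩ inEdges Xᶜ = Q := by
  have n1 := not_cross_of_in X
  have n2 := not_in_both X
  refine ⟨?_, ?_, ?_⟩ <;> ext e <;> have := @hC e <;> have := @hP e <;> have := @hQ e <;>
    have := n1 e <;> have := n2 e <;> simp only [Set.mem_inter_iff, Set.mem_union] <;> tauto

theorem card_fiber {V : Type*} [Finite V] (G : SimpleGraph V) (X : Set V)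
    (hX : ∀ u ∈ X, ∀ v ∈ X, u ≠ v → G.Adj u v)
    (hXc : ∀ u ∈ Xᶜ, ∀ v ∈ Xᶜ, u ≠ v → G.Adj u v)
    (C : Set (Sym2 V)) (hC : IsMatching G C) (hCX : C ⊆ crossEdges X) :
    Nat.card {M : {M : Set (Sym2 V) // IsPM G M} // M.1 ∩ crossEdges X = C} =
      numPMComplete (X.ncard - C.ncard) * numPMComplete (Xᶜ.ncard - C.ncard) := by
  have hY : CrossAll Xᶜ X C := fun e he => by
    obtain ⟨u, hu, v, hv, rfl⟩ := hCX he
    exact ⟨v, hv, u, hu, Sym2.eq_swap⟩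
  rw [← (ncard_diff_covered X Xᶜ disjoint_compl_right C hC.2 hCX).2,
    ← (ncard_diff_covered Xᶜ X disjoint_compl_left C hC.2 hY).2,
    ← card_PMOn, ← card_PMOn, ← Nat.card_prod]
  have key : ∀ P Q, PMOn (X \ covered C) P → PMOn (Xᶜ \ covered C) Q →
      (C ∪ P ∪ Q) ∩ crossEdges X = C ∧ (C ∪ P ∪ Q) ∩ inEdges X = P ∧
      (C ∪ P ∪ Q) ∩ inEdges Xᶜ = Q := fun P Q hP hQ =>
    union_inter X C P Q hCX (fun e he v hv => (hP.2.1 e he v hv).1)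
      (fun e he v hv => (hQ.2.1 e he v hv).1)
  refine Nat.card_congr ⟨fun M => ⟨⟨M.1.1 ∩ inEdges X, ?_⟩, ⟨M.1.1 ∩ inEdges Xᶜ, ?_⟩⟩,
    fun PQ => ⟨⟨C ∪ PQ.1.1 ∪ PQ.2.1, IsPM_union G X hX hXc C _ _ hC PQ.1.2 PQ.2.2⟩,
      (key _ _ PQ.1.2 PQ.2.2).1⟩, ?_, ?_⟩
  · have := PMOn_restrict G X X (Or.inl rfl) M.1.1 M.1.2
    rwa [M.2] at this
  · have := PMOn_restrict G X Xᶜ (Or.inr rfl) M.1.1 M.1.2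
    rwa [M.2] at this
  · rintro ⟨⟨M, hM⟩, rfl⟩
    apply Subtype.ext
    apply Subtype.ext
    ext e
    have := edge_cases_s19 X e
    simp only [Set.mem_inter_iff, Set.mem_union]
    tauto
  · rintro ⟨⟨P, hP⟩, ⟨Q, hQ⟩⟩
    have := key P Q hP hQ
    exact Prod.ext (Subtype.ext this.2.1) (Subtype.ext this.2.2)

/-- If the vertex set of a finite graph `G` partitions into
two cliques `X` (of size `n`) and `Xᶜ` (of size `m`), and `Mₛ` denotes the
number of matchings of `G` of size `s` all of whose edges join `X` to `Xᶜ`,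
then the number of perfect matchings of `G` is
`∑_{s = 0}^{min n m} Mₛ · p(n - s) · p(m - s)`. -/
theorem card_perfectMatchings_of_two_cliques {V : Type*} [Fintype V]
    (G : SimpleGraph V) (X : Set V)
    (hX : ∀ u ∈ X, ∀ v ∈ X, u ≠ v → G.Adj u v)
    (hXc : ∀ u ∈ Xᶜ, ∀ v ∈ Xᶜ, u ≠ v → G.Adj u v)
    (n m : ℕ) (hn : X.ncard = n) (hm : Xᶜ.ncard = m) :
    Nat.card {M : Set (Sym2 V) // IsPM G M} =
      ∑ s ∈ Finset.range (min n m + 1),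
        Nat.card {M : Set (Sym2 V) // IsMatching G M ∧ M.ncard = s ∧
            ∀ e ∈ M, ∃ u ∈ X, ∃ v ∈ Xᶜ, e = s(u, v)} *
          numPMComplete (n - s) * numPMComplete (m - s) := by
  classical
  subst hn hm
  let K := {C : Set (Sym2 V) // IsMatching G C ∧ C ⊆ crossEdges X}
  have : Fintype K := Fintype.ofFinite K
  let φ : {M : Set (Sym2 V) // IsPM G M} → K := fun M =>
    ⟨M.1 ∩ crossEdges X, ⟨fun e he => M.2.1 he.1, fun e he f hf => M.2.2.1 e he.1 f hf.1⟩,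
      Set.inter_subset_right⟩
  rw [← Nat.card_congr (Equiv.sigmaFiberEquiv φ), Nat.card_sigma]
  have h1 : ∀ C : K, Nat.card {M // φ M = C} =
      numPMComplete (X.ncard - C.1.ncard) * numPMComplete (Xᶜ.ncard - C.1.ncard) := by
    intro C
    rw [← card_fiber G X hX hXc C.1 C.2.1 C.2.2]
    exact Nat.card_congr (Equiv.subtypeEquivRight fun M => Subtype.ext_iff)
  rw [Finset.sum_congr rfl fun C _ => h1 C]
  have hmaps : ∀ C ∈ (Finset.univ : Finset K),
      C.1.ncard ∈ Finset.range (min X.ncard Xᶜ.ncard + 1) := by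
    intro C _
    have hY : CrossAll Xᶜ X C.1 := fun e he => by
      obtain ⟨u, hu, v, hv, rfl⟩ := C.2.2 he
      exact ⟨v, hv, u, hu, Sym2.eq_swap⟩
    have a := (ncard_diff_covered X Xᶜ disjoint_compl_right C.1 C.2.1.2 C.2.2).1
    have b := (ncard_diff_covered Xᶜ X disjoint_compl_left C.1 C.2.1.2 hY).1
    rw [Finset.mem_range]
    omega
  rw [← Finset.sum_fiberwise_of_maps_to hmaps]
  refine Finset.sum_congr rfl fun s _ => ?_
  rw [Finset.sum_congr rfl (g := fun _ =>
    numPMComplete (X.ncard - s) * numPMComplete (Xᶜ.ncard - s))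
    (fun C hC => by rw [(Finset.mem_filter.1 hC).2])]
  rw [Finset.sum_const, smul_eq_mul, mul_assoc]
  congr 1
  rw [← Fintype.card_subtype, ← Nat.card_eq_fintype_card]
  exact Nat.card_congr
    ⟨fun C => ⟨C.1.1, C.1.2.1, C.2, C.1.2.2⟩, fun C => ⟨⟨C.1, C.2.1, C.2.2.2⟩, C.2.2.1⟩,
      fun _ => rfl, fun _ => rfl⟩
end
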